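/- arXiv:0901.1174 — 2 statements merged into one kernel-verified Lean document; each statement's English description precedes it below -/
import Mathlib

section
/- Let R be a commutative noetherian local ring with residue field k, and assume either that R is complete (m-adically complete, where m is the maximal ideal) or that k is uncountable. Let 𝒳 be a class of finitely generated R-modules such that the resolving closure res 𝒳 has countable type, i.e., there are at most countably many isomorphism classes of indecomposable finitely generated R-modules in res 𝒳. Then dim NF(𝒳) ≤ 1. -/
open CategoryTheory

noncomputable section

variable (R : Type) [CommRing R]

/-- The nonfree locus of a module: primes where the localization is not free. -/
def nonfreeLocus (M : ModuleCat R) : Set (PrimeSpectrum R) :=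
  {p | ¬ Module.Free (Localization.AtPrime p.asIdeal)
      (LocalizedModule p.asIdeal.primeCompl M)}

/-- The nonfree locus of a class of modules. -/
def nonfreeLocusSet (𝒳 : Set (ModuleCat R)) : Set (PrimeSpectrum R) :=
  ⋃ X ∈ 𝒳, nonfreeLocus R X

/-- `N` is a direct summand of `M`. -/
def IsSummand (N M : ModuleCat R) : Prop :=
  ∃ (i : N ⟶ M) (p : M ⟶ N), i ≫ p = 𝟙 N

/-- `0 → L → M → N → 0` is a short exact sequence. -/
def SES (L M N : ModuleCat R) : Prop :=
  ∃ (f : L ⟶ M) (g : M ⟶ N),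
    Function.Injective f ∧ Function.Surjective g ∧ Function.Exact f g

/-- A resolving class of finitely generated modules. -/
structure IsResolving (𝒳 : Set (ModuleCat R)) : Prop where
  finite : ∀ M ∈ 𝒳, Module.Finite R M
  iso_closed : ∀ M N : ModuleCat R, Nonempty (M ≅ N) → M ∈ 𝒳 → N ∈ 𝒳
  proj_mem : ∀ M : ModuleCat R, Module.Finite R M → Module.Projective R M → M ∈ 𝒳
  summand_closed : ∀ M N : ModuleCat R, IsSummand R N M → M ∈ 𝒳 → N ∈ 𝒳
  ext_closed : ∀ L M N : ModuleCat R, SES R L M N → L ∈ 𝒳 → N ∈ 𝒳 → M ∈ 𝒳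
  ker_epi_closed : ∀ L M N : ModuleCat R, SES R L M N → M ∈ 𝒳 → N ∈ 𝒳 → L ∈ 𝒳

/-- The resolving closure of a class of modules. -/
def resClosure (𝒳 : Set (ModuleCat R)) : Set (ModuleCat R) :=
  ⋂₀ {𝒴 | IsResolving R 𝒴 ∧ 𝒳 ⊆ 𝒴}

/-- Finite direct sum of a family of modules. -/
def finDirectSum {n : ℕ} (f : Fin n → ModuleCat R) : ModuleCat R :=
  ModuleCat.of R (∀ i, f i)

/-- The class `res^n X`. -/
def resStep (X : ModuleCat R) : ℕ → Set (ModuleCat R)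
  | 0 => {M | ∃ (n : ℕ) (f : Fin n → ModuleCat R),
      (∀ i, f i = X ∨ f i = ModuleCat.of R R) ∧ IsSummand R M (finDirectSum R f)}
  | (n+1) => {M | ∃ (t : ℕ) (f : Fin t → ModuleCat R),
      (∀ i, (∃ A B, A ∈ resStep X n ∧ B ∈ resStep X n ∧ SES R A (f i) B) ∨
            (∃ A B, A ∈ resStep X n ∧ B ∈ resStep X n ∧ SES R (f i) A B)) ∧
      IsSummand R M (finDirectSum R f)}

/-- `step(X,Y)` : the least `n` with `Y ∈ res^n X`. -/
def step (X Y : ModuleCat R) : ℕ∞ :=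
  sInf {n : ℕ∞ | ∃ m : ℕ, n = (m : ℕ∞) ∧ Y ∈ resStep R X m}

/-- A module is indecomposable. -/
def Indec (M : ModuleCat R) : Prop :=
  Nontrivial M ∧ ∀ (A B : ModuleCat R), Nontrivial A → Nontrivial B →
    IsEmpty (M ≅ ModuleCat.of R (A × B))

/-- `Ext¹`. -/
def ext1 (X Y : ModuleCat R) : ModuleCat R :=
  ((Ext R (ModuleCat R) 1).obj (Opposite.op X)).obj Y

/-- Dimension of a subset of `Spec R` : `sup { dim R/p }`. -/
def dimSet (Z : Set (PrimeSpectrum R)) : WithBot ℕ∞ :=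
  ⨆ p ∈ Z, ringKrullDim (R ⧸ (p : PrimeSpectrum R).asIdeal)

/-- The height of `p` with respect to a subset `Z` of `Spec R`. -/
def heightWithin (Z : Set (PrimeSpectrum R)) (p : PrimeSpectrum R) : ℕ∞ :=
  ⨆ q ∈ Z, ⨆ (h : q ≤ p), Order.height (α := Set.Icc q p) ⟨p, ⟨h, le_rfl⟩⟩

/-- Depth of a module over a local ring : the supremum of lengths of regular
sequences contained in the maximal ideal. -/
def moduleDepth [IsLocalRing R] (M : Type) [AddCommGroup M] [Module R M] : ℕ∞ :=
  ⨆ (rs : List R) (_ : (∀ r ∈ rs, r ∈ IsLocalRing.maximalIdeal R) ∧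
      RingTheory.Sequence.IsRegular M rs), (rs.length : ℕ∞)

/-- The singular locus: primes `p` such that `R_p` is not regular, i.e. the maximal
ideal of `R_p` cannot be generated by `dim R_p` elements. -/
def singularLocus : Set (PrimeSpectrum R) :=
  {p | ¬ ∃ (s : Finset (Localization.AtPrime p.asIdeal)),
      Ideal.span (s : Set (Localization.AtPrime p.asIdeal)) =
        IsLocalRing.maximalIdeal (Localization.AtPrime p.asIdeal) ∧
      (s.card : WithBot ℕ∞) = ringKrullDim (Localization.AtPrime p.asIdeal)}

end

section FactorsThroughFree

universe u v w

variable {R : Type u} [CommRing R]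
variable {M : Type v} [AddCommGroup M] [Module R M] {N : Type w} [AddCommGroup N] [Module R N]

/-- Multiplication by `s` on `M` factors through a finite free module. -/
def FactorsThroughFree (s : R) (M : Type v) [AddCommGroup M] [Module R M] : Prop :=
  ∃ (n : ℕ) (f : M →ₗ[R] Fin n → R) (g : (Fin n → R) →ₗ[R] M), g ∘ₗ f = s • LinearMap.id

theorem FactorsThroughFree.of_projective {s : R} [Module.Finite R N] [Module.Projective R N]
    (f : M →ₗ[R] N) (g : N →ₗ[R] M) (h : ∀ m, g (f m) = s • m) : FactorsThroughFree s M := by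
  obtain ⟨n, π, hπ⟩ := Module.Finite.exists_fin' R N
  obtain ⟨σ, hσ⟩ := Module.projective_lifting_property π LinearMap.id hπ
  refine ⟨n, σ ∘ₗ f, g ∘ₗ π, LinearMap.ext fun m => ?_⟩
  have := LinearMap.congr_fun hσ (f m)
  simp only [LinearMap.comp_apply, LinearMap.id_apply] at this
  simp [this, h]

theorem FactorsThroughFree.exists_section {s : R} (h : FactorsThroughFree s M)
    (π : N →ₗ[R] M) (hπ : Function.Surjective π) : ∃ σ : M →ₗ[R] N, ∀ m, π (σ m) = s • m := by
  obtain ⟨n, f, g, hfg⟩ := h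
  obtain ⟨l, hl⟩ := Module.projective_lifting_property π g hπ
  refine ⟨l ∘ₗ f, fun m => ?_⟩
  have h₁ := LinearMap.congr_fun hl (f m)
  have h₂ := LinearMap.congr_fun hfg m
  simp only [LinearMap.comp_apply] at h₁ h₂ ⊢
  rw [h₁, h₂]
  simp

theorem FactorsThroughFree.of_retract {s : R} (h : FactorsThroughFree s M)
    (i : N →ₗ[R] M) (p : M →ₗ[R] N) (hip : ∀ x, p (i x) = x) : FactorsThroughFree s N := by
  obtain ⟨n, f, g, hfg⟩ := h
  refine ⟨n, f ∘ₗ i, p ∘ₗ g, LinearMap.ext fun x => ?_⟩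
  have h₂ := LinearMap.congr_fun hfg (i x)
  simp only [LinearMap.comp_apply] at h₂ ⊢
  rw [h₂]
  simp [hip]

theorem FactorsThroughFree.prod {s t : R} (hM : FactorsThroughFree s M)
    (hN : FactorsThroughFree t N) : FactorsThroughFree (s * t) (M × N) := by
  obtain ⟨m, f, g, hfg⟩ := hM
  obtain ⟨n, f', g', hfg'⟩ := hN
  refine .of_projective (f.prodMap f') ((t • g).prodMap (s • g')) fun ⟨x, y⟩ => ?_
  have h₁ := LinearMap.congr_fun hfg x
  have h₂ := LinearMap.congr_fun hfg' y
  simp only [LinearMap.comp_apply] at h₁ h₂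
  simp [h₁, h₂, mul_smul, smul_comm s t]

/-- The pullback of `π : F → X` along multiplication by `x` on `X`. -/
abbrev scaledPullback (π : N →ₗ[R] M) (x : R) : Submodule R (N × M) :=
  LinearMap.ker (π ∘ₗ LinearMap.fst R N M - x • LinearMap.snd R N M)

theorem mem_scaledPullback {π : N →ₗ[R] M} {x : R} {z : N × M} :
    z ∈ scaledPullback π x ↔ π z.1 = x • z.2 := by
  simp [scaledPullback, sub_eq_zero]

/-- The map `N → N ×_M M` into the scaled pullback given by `a ↦ (x a, π a)`. -/
def scaledPullbackLift (π : N →ₗ[R] M) (x : R) : N →ₗ[R] scaledPullback π x :=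
  ((x • LinearMap.id).prod π).codRestrict _ fun a => by simp

@[simp]
theorem scaledPullbackLift_apply (π : N →ₗ[R] M) (x : R) (a : N) :
    (scaledPullbackLift π x a : N × M) = (x • a, π a) := rfl

theorem factorsThroughFree_scaledPullback [Module.Finite R N] [Module.Projective R N]
    (π : N →ₗ[R] M) (x : R) : FactorsThroughFree x (scaledPullback π x) := by
  refine .of_projective (LinearMap.fst R N M ∘ₗ (scaledPullback π x).subtype)
    (scaledPullbackLift π x) fun z => Subtype.ext ?_
  have := mem_scaledPullback.1 z.2
  ext <;> simp [this]

theorem FactorsThroughFree.scaledPullback [Module.Finite R N] [Module.Projective R N]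
    {s : R} (hs : FactorsThroughFree s M) (π : N →ₗ[R] M) (hπ : Function.Surjective π) (x : R) :
    FactorsThroughFree (s * s) (scaledPullback π x) := by
  obtain ⟨h, hh⟩ := hs.exists_section π hπ
  let ι := (_root_.scaledPullback π x).subtype
  let φ := LinearMap.fst R N M ∘ₗ ι
  let ρ := LinearMap.snd R N M ∘ₗ ι
  let e : N →ₗ[R] N := s • LinearMap.id - h ∘ₗ π
  let g : N × N →ₗ[R] _root_.scaledPullback π x :=
    (s • scaledPullbackLift π x).coprod
      (((LinearMap.inl R N M) ∘ₗ e).codRestrict _ fun a => by simp [e, hh])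
  have hg : ∀ a b, (g (a, b) : N × M) = s • (x • a, π a) + (s • b - h (π b), 0) := fun _ _ => rfl
  refine .of_projective ((h ∘ₗ ρ).prod (s • φ - x • (h ∘ₗ ρ))) g fun z => Subtype.ext ?_
  have hz := mem_scaledPullback.1 z.2
  refine Prod.ext ?_ ?_
  · simp [hg, φ, ρ, ι, hz, hh, mul_smul, smul_sub, smul_comm s x]
  · simp [hg, φ, ρ, ι, hh, mul_smul]

/-- An endomorphism of the form `s - β`, where `β` maps into `p M`, divides multiplication by some
element outside `p`, when `s ∉ p`. -/
theorem exists_comp_eq_smul_of_range_le [Module.Finite R M] {p : Ideal R} [p.IsPrime] {s : R}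
    (hs : s ∉ p) (β : Module.End R M) (hβ : LinearMap.range β ≤ p • ⊤) :
    ∃ t ∉ p, ∃ γ : Module.End R M, ∀ m, γ (s • m - β m) = t • m := by
  obtain ⟨Q, hQm, -, hQc, hQ⟩ :=
    LinearMap.exists_monic_and_natDegree_eq_and_coeff_mem_pow_and_aeval_eq_zero R β p hβ
  refine ⟨Q.eval s, fun hmem => hs ?_, ?_⟩
  · rw [Polynomial.eval_eq_sum_range, Finset.sum_range_succ, hQm.coeff_natDegree, one_mul] at hmem
    refine Ideal.IsPrime.mem_of_pow_mem ‹_› Q.natDegree ?_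
    refine (Ideal.add_mem_iff_right _ (Ideal.sum_mem _ fun k hk => ?_)).1 hmem
    refine Ideal.mul_mem_right _ _ (Ideal.pow_le_self ?_ (hQc k))
    have := Finset.mem_range.1 hk
    omega
  · obtain ⟨q, hq⟩ := Polynomial.X_sub_C_dvd_sub_C_eval (a := s) (p := Q)
    refine ⟨Polynomial.aeval β q, fun m => ?_⟩
    have h := congrArg (fun P => Polynomial.aeval β P m) hq
    simp only [mul_comm _ q, map_sub, map_mul, hQ, Polynomial.aeval_X, Polynomial.aeval_C,
      Module.End.mul_apply, LinearMap.sub_apply, LinearMap.zero_apply,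
      Module.algebraMap_end_apply] at h
    rw [zero_sub, neg_eq_iff_eq_neg] at h
    rw [map_sub, h]
    simp

theorem FactorsThroughFree.of_scaledPullback [IsNoetherianRing R] [Module.Finite R N]
    [Module.Projective R N] {p : Ideal R} [p.IsPrime] {x s : R} (hx : x ∈ p) (hs : s ∉ p)
    (π : N →ₗ[R] M) (hπ : Function.Surjective π)
    (h : FactorsThroughFree s (_root_.scaledPullback π x)) :
    ∃ t ∉ p, FactorsThroughFree t M := by
  obtain ⟨n, f, g, hfg⟩ := h
  obtain ⟨l, hl⟩ := Module.projective_lifting_property π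
    ((LinearMap.snd R N M ∘ₗ (_root_.scaledPullback π x).subtype) ∘ₗ g) hπ
  have hv : ∀ z, π ((l ∘ₗ f) z) = s • z.1.2 := fun z => by
    have h₁ := LinearMap.congr_fun hl (f z)
    have h₂ := LinearMap.congr_fun hfg z
    simp only [LinearMap.comp_apply] at h₁ h₂ ⊢
    rw [h₁, h₂]
    simp
  generalize l ∘ₗ f = v at hv
  let j : LinearMap.ker π →ₗ[R] _root_.scaledPullback π x :=
    (LinearMap.inl R N M ∘ₗ (LinearMap.ker π).subtype).codRestrict _ fun a => by
      simp
  have hj : ∀ a, (j a : N × M) = (a.1, 0) := fun _ => rfl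
  let α : LinearMap.ker π →ₗ[R] LinearMap.ker π :=
    (v ∘ₗ j).codRestrict _ fun a => by simp [hv, hj]
  let E : N →ₗ[R] LinearMap.ker π :=
    (s • LinearMap.id - v ∘ₗ scaledPullbackLift π x).codRestrict _ fun a => by simp [hv]
  have hE : ∀ a : LinearMap.ker π, E a = s • a - (x • α) a := fun a => by
    refine Subtype.ext ?_
    have : scaledPullbackLift π x a = x • j a := Subtype.ext (by simp [hj])
    simp [E, α, this]
  obtain ⟨t, ht, γ, hγ⟩ := exists_comp_eq_smul_of_range_le hs (x • α) (by
    rintro _ ⟨a, rfl⟩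
    exact Submodule.smul_mem_smul hx trivial)
  let k : N →ₗ[R] N := t • LinearMap.id - (LinearMap.ker π).subtype ∘ₗ γ ∘ₗ E
  have hk : LinearMap.ker π ≤ LinearMap.ker k := fun a ha => by
    have h₁ := hγ ⟨a, ha⟩
    rw [← hE] at h₁
    simp [k, h₁]
  let k' := (LinearMap.ker π).liftQ k hk ∘ₗ (π.quotKerEquivOfSurjective hπ).symm.toLinearMap
  refine ⟨t, ht, .of_projective k' π fun m => ?_⟩
  obtain ⟨a, rfl⟩ := hπ m
  have : (π.quotKerEquivOfSurjective hπ).symm (π a) = (LinearMap.ker π).mkQ a := by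
    rw [LinearEquiv.symm_apply_eq]
    rfl
  simp [k', this, k]

theorem free_localizedModule_iff [Module.FinitePresentation R M] (p : Ideal R) [p.IsPrime] :
    Module.Free (Localization.AtPrime p) (LocalizedModule p.primeCompl M) ↔
      ∃ s ∉ p, FactorsThroughFree s M := by
  constructor
  · intro hfree
    obtain ⟨n, π, hπ⟩ := Module.Finite.exists_fin' R M
    have hπ' : Function.Surjective (LocalizedModule.map p.primeCompl π) :=
      LocalizedModule.map_surjective p.primeCompl π hπ
    obtain ⟨σ, hσ⟩ := Module.projective_lifting_property _ LinearMap.id hπ'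
    obtain ⟨h, s, hs⟩ := Module.FinitePresentation.exists_lift_of_isLocalizedModule p.primeCompl
      (LocalizedModule.mkLinearMap p.primeCompl (Fin n → R))
      (σ.restrictScalars R ∘ₗ LocalizedModule.mkLinearMap p.primeCompl M)
    obtain ⟨t, ht⟩ := Module.Finite.exists_smul_of_comp_eq_of_isLocalizedModule p.primeCompl
      (LocalizedModule.mkLinearMap p.primeCompl M) (π ∘ₗ h) (s.1 • LinearMap.id) (by
        ext m
        have h₁ := LinearMap.congr_fun hs m
        have h₂ := congrArg ((LocalizedModule.map p.primeCompl π).restrictScalars R) h₁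
        have h₃ := LinearMap.congr_fun hσ (LocalizedModule.mkLinearMap p.primeCompl M m)
        simp only [LinearMap.comp_apply, LinearMap.smul_apply, Submonoid.smul_def, map_smul,
          LinearMap.coe_restrictScalars, LinearMap.id_apply] at h₁ h₂ h₃ ⊢
        rw [h₃] at h₂
        rw [← h₂]
        exact (LocalizedModule.map_mk p.primeCompl π _ _).symm)
    refine ⟨t.1 * s.1, p.primeCompl.mul_mem t.2 s.2, n, h, t.1 • π, ?_⟩
    ext m
    have := LinearMap.congr_fun ht m
    simpa [mul_smul, Submonoid.smul_def] using this
  · rintro ⟨s, hs, n, f, g, hfg⟩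
    have : Module.Projective (Localization.AtPrime p) (LocalizedModule p.primeCompl M) := by
      have hu : IsUnit (algebraMap R (Localization.AtPrime p) s) :=
        IsLocalization.map_units _ (⟨s, hs⟩ : p.primeCompl)
      obtain ⟨c, hc⟩ := hu.exists_left_inv
      refine .of_split (LocalizedModule.map p.primeCompl f)
        (c • LocalizedModule.map p.primeCompl g) (LinearMap.ext fun z => ?_)
      induction z using LocalizedModule.induction_on with | _ m t
      have h := LinearMap.congr_fun hfg m
      simp only [LinearMap.comp_apply, LinearMap.smul_apply, LinearMap.id_apply] at h
      rw [LinearMap.comp_apply, LinearMap.smul_apply, LocalizedModule.map_mk,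
        LocalizedModule.map_mk, h, ← LocalizedModule.smul'_mk, ← algebraMap_smul
          (Localization.AtPrime p) s, smul_smul, hc, one_smul, LinearMap.id_apply]
    exact Module.free_of_flat_of_isLocalRing

end FactorsThroughFree

section PrimeAvoidance

variable {R : Type*} [CommRing R] [IsNoetherianRing R] [IsLocalRing R]

open IsLocalRing

theorem exists_notMem_sup_maximalIdeal_pow (I : Ideal R) {y : R} (hy : y ∉ I) :
    ∃ n, y ∉ I ⊔ maximalIdeal R ^ n := by
  by_contra! h
  apply hy
  rw [← Ideal.Quotient.eq_zero_iff_mem, ← Submodule.mem_bot R,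
    ← Ideal.iInf_pow_smul_eq_bot_of_isLocalRing (M := R ⧸ I) (maximalIdeal R) (by
      exact Ideal.IsPrime.ne_top'), Submodule.mem_iInf]
  intro n
  obtain ⟨a, ha, b, hb, rfl⟩ := Submodule.mem_sup.1 (h n)
  rw [map_add, Ideal.Quotient.eq_zero_iff_mem.2 ha, zero_add]
  have : Ideal.Quotient.mk I b = b • (1 : R ⧸ I) := by
    rw [Algebra.smul_def, mul_one]
    rfl
  rw [this]
  exact Submodule.smul_mem_smul hb trivial

/-- Countable prime avoidance for the maximal ideal of a complete local ring. -/
theorem exists_maximalIdeal_le_of_isAdicComplete [IsAdicComplete (maximalIdeal R) R]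
    (P : ℕ → Ideal R) (hP : ∀ i, (P i).IsPrime) (hcov : ∀ x ∈ maximalIdeal R, ∃ i, x ∈ P i) :
    ∃ i, maximalIdeal R ≤ P i := by
  by_contra! hle
  have next : ∀ (i : ℕ) (s : R × ℕ), ∃ s' : R × ℕ, s.2 < s'.2 ∧
      s'.1 - s.1 ∈ maximalIdeal R ^ s.2 ∧ s'.1 ∉ P i ⊔ maximalIdeal R ^ s'.2 := by
    rintro i ⟨x, n⟩
    obtain ⟨y, hyx, hy⟩ : ∃ y, y - x ∈ maximalIdeal R ^ n ∧ y ∉ P i := by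
      by_contra! h
      refine hle i ((hP i).le_of_pow_le (n := n) fun z hz => ?_)
      exact (Ideal.add_mem_iff_right _ (h x (by simp))).1 (h (x + z) (by simpa using hz))
    obtain ⟨m, hm⟩ := exists_notMem_sup_maximalIdeal_pow (P i) hy
    refine ⟨(y, m + n + 1), by dsimp; omega, hyx, fun h => hm ?_⟩
    have hpow : maximalIdeal R ^ (m + n + 1) ≤ maximalIdeal R ^ m :=
      Ideal.pow_le_pow_right (by omega)
    exact (sup_le_sup_left hpow (P i) :) h
  choose F hF₁ hF₂ hF₃ using next
  let σ : ℕ → R × ℕ := fun n => Nat.rec (0, 1) F n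
  have hmono : StrictMono fun n => (σ n).2 := strictMono_nat_of_lt_succ fun n => hF₁ n (σ n)
  have hcauchy : ∀ {a b : ℕ}, a ≤ b → (σ b).1 - (σ a).1 ∈ maximalIdeal R ^ (σ a).2 := by
    intro a b hab
    induction b, hab using Nat.le_induction with
    | base => simp
    | succ b hab ih =>
      have h := Ideal.pow_le_pow_right (I := maximalIdeal R) (hmono.monotone hab) (hF₂ b (σ b))
      simpa using Ideal.add_mem _ h ih
  obtain ⟨L, hL⟩ := IsPrecomplete.prec (I := maximalIdeal R) (M := R) inferInstance
    (f := fun n => (σ n).1) fun {a b} hab => by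
      rw [SModEq.comm, SModEq.sub_mem, smul_eq_mul, Ideal.mul_top]
      exact Ideal.pow_le_pow_right hmono.le_apply (hcauchy hab)
  have hlim : ∀ n, L - (σ n).1 ∈ maximalIdeal R ^ (σ n).2 := fun n => by
    have h := (hL (σ n).2).symm
    rw [SModEq.sub_mem, smul_eq_mul, Ideal.mul_top] at h
    simpa using Ideal.add_mem _ h (hcauchy hmono.le_apply)
  obtain ⟨i, hi⟩ := hcov L (by simpa [σ] using hlim 0)
  refine hF₃ i (σ i) ?_
  have h := Submodule.add_mem_sup hi ((maximalIdeal R ^ (σ (i + 1)).2).neg_mem (hlim (i + 1)))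
  simpa using h

/-- Countable prime avoidance for the maximal ideal of a local ring with uncountable residue
field. -/
theorem exists_maximalIdeal_le_of_uncountable [Uncountable (ResidueField R)]
    (P : ℕ → Ideal R) (hcov : ∀ x ∈ maximalIdeal R, ∃ i, x ∈ P i) :
    ∃ i, maximalIdeal R ≤ P i := by
  obtain ⟨n, x, hx⟩ := Submodule.fg_iff_exists_fin_generating_family.1
    (IsNoetherian.noetherian (maximalIdeal R))
  have hxm : ∀ j, x j ∈ maximalIdeal R := fun j => hx ▸ Submodule.subset_span ⟨j, rfl⟩
  obtain ⟨t, ht⟩ := (residue_surjective (R := R)).hasRightInverse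
  choose c hc using fun κ : ResidueField R => hcov (∑ j : Fin n, t κ ^ (j : ℕ) * x j)
    (Ideal.sum_mem _ fun j _ => Ideal.mul_mem_left _ _ (hxm j))
  obtain ⟨i, hi⟩ : ∃ i, (c ⁻¹' {i}).Infinite := by
    by_contra! h
    refine not_countable (α := ResidueField R) (Set.countable_univ_iff.1 ?_)
    rw [← Set.preimage_univ (f := c), ← Set.iUnion_of_singleton, Set.preimage_iUnion]
    exact Set.countable_iUnion fun i => (h i).countable
  refine ⟨i, ?_⟩
  let κ : Fin n → ResidueField R := fun j => hi.natEmbedding _ j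
  have hκ : Function.Injective κ := fun a b hab =>
    Fin.ext ((hi.natEmbedding _).injective (Subtype.ext hab))
  let V := Matrix.vandermonde fun j => t (κ j)
  have hV : IsUnit V.det := by
    rw [← residue_ne_zero_iff_isUnit, RingHom.map_det]
    have : (residue R).mapMatrix V = Matrix.vandermonde κ := by
      ext a b
      simp [V, Matrix.vandermonde_apply, ht (κ a)]
    rw [this]
    exact Matrix.det_vandermonde_ne_zero_iff.2 hκ
  rw [← hx, Submodule.span_le]
  rintro _ ⟨j, rfl⟩
  have hVx : ∀ a, V.mulVec x a ∈ P i := fun a => by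
    have : c (κ a) = i := (hi.natEmbedding _ a).2
    exact this ▸ hc (κ a)
  have hmem : V.det * x j ∈ P i := by
    have : V.adjugate.mulVec (V.mulVec x) j = V.det * x j := by
      rw [Matrix.mulVec_mulVec, Matrix.adjugate_mul]
      simp [Matrix.smul_mulVec]
    rw [← this]
    rw [Matrix.mulVec_eq_sum]
    simp only [Finset.sum_apply, Pi.smul_apply, Matrix.transpose_apply]
    exact Ideal.sum_mem _ fun a _ => Ideal.mul_mem_left _ _ (hVx a)
  exact (Ideal.unit_mul_mem_iff_mem _ hV).1 hmem

theorem ringKrullDim_quotient_le_one_of_countable_zeroLocus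
    (hR : IsAdicComplete (maximalIdeal R) R ∨ Uncountable (ResidueField R))
    (p : Ideal R) [p.IsPrime] (hp : (PrimeSpectrum.zeroLocus (p : Set R)).Countable) :
    ringKrullDim (R ⧸ p) ≤ 1 := by
  by_contra! hdim
  have hloc : IsLocalRing (R ⧸ p) := .of_surjective' _ Ideal.Quotient.mk_surjective
  let T := {q ∈ PrimeSpectrum.zeroLocus (p : Set R) | q.asIdeal ≠ maximalIdeal R}
  have hT : T.Countable := hp.mono (Set.sep_subset _ _)
  have hcov : ∀ x ∈ maximalIdeal R, ∃ q ∈ T, x ∈ q.asIdeal := by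
    intro x hx
    have hne : Ideal.span {Ideal.Quotient.mk p x} ≠ ⊤ := by
      rw [Ne, Ideal.span_singleton_eq_top]
      intro hu
      have := IsLocalHom.of_surjective (Ideal.Quotient.mk p) Ideal.Quotient.mk_surjective
      exact hx ((isUnit_map_iff (Ideal.Quotient.mk p) x).1 hu)
    obtain ⟨q, hq⟩ := Ideal.nonempty_minimalPrimes hne
    have := hq.1.1
    have hht := Ideal.height_le_one_of_isPrincipal_of_mem_minimalPrimes _ q hq
    refine ⟨⟨q.comap (Ideal.Quotient.mk p), inferInstance⟩, ⟨?_, fun heq => ?_⟩, ?_⟩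
    · intro y hy
      simp [Ideal.Quotient.eq_zero_iff_mem.2 hy]
    · have hmax : q = maximalIdeal (R ⧸ p) := by
        refine le_antisymm (le_maximalIdeal hq.1.1.ne_top) fun y hy => ?_
        obtain ⟨y, rfl⟩ := Ideal.Quotient.mk_surjective y
        have : y ∈ maximalIdeal R := fun hu => hy (hu.map _)
        exact heq.ge this
      rw [← maximalIdeal_height_eq_ringKrullDim, ← hmax] at hdim
      exact absurd hdim (not_lt.2 (by exact_mod_cast hht))
    · exact hq.1.2 (Ideal.mem_span_singleton_self _)
  obtain ⟨q₀, hq₀, -⟩ := hcov 0 (zero_mem _)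
  obtain ⟨P, hP⟩ := hT.exists_eq_range ⟨q₀, hq₀⟩
  have hcov' : ∀ x ∈ maximalIdeal R, ∃ i, x ∈ (P i).asIdeal := fun x hx => by
    obtain ⟨q, hq, hxq⟩ := hcov x hx
    obtain ⟨i, rfl⟩ := hP ▸ hq
    exact ⟨i, hxq⟩
  obtain ⟨i, hi⟩ : ∃ i, maximalIdeal R ≤ (P i).asIdeal := by
    rcases hR with hR | hR
    · exact exists_maximalIdeal_le_of_isAdicComplete _ (fun i => (P i).2) hcov'
    · exact exists_maximalIdeal_le_of_uncountable _ hcov'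
  have hiT : P i ∈ T := hP ▸ ⟨i, rfl⟩
  exact hiT.2 (le_antisymm (le_maximalIdeal (P i).2.ne_top) hi)

end PrimeAvoidance

section Resolving

universe u v

variable {R : Type} [CommRing R]

theorem mem_zeroLocus_asIdeal (p : PrimeSpectrum R) :
    p ∈ PrimeSpectrum.zeroLocus (p.asIdeal : Set R) :=
  fun _ => id

theorem IsResolving.scaledPullback_mem {𝒴 : Set (ModuleCat.{u} R)} (h𝒴 : IsResolving R 𝒴)
    {X : ModuleCat.{u} R} (hX : X ∈ 𝒴) {n : ℕ} (π : (Fin n → R) →ₗ[R] X)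
    (hπ : Function.Surjective π) (x : R) : ModuleCat.of R (scaledPullback π x) ∈ 𝒴 := by
  let F := ModuleCat.of R (ULift.{u} (Fin n → R))
  let K := ModuleCat.of R (ULift.{u} (LinearMap.ker π))
  have hF : F ∈ 𝒴 := h𝒴.proj_mem F
    (Module.Finite.equiv (ULift.moduleEquiv (R := R) (M := Fin n → R)).symm)
    (Module.Projective.of_equiv (ULift.moduleEquiv (R := R) (M := Fin n → R)).symm)
  have hK : K ∈ 𝒴 := by
    refine h𝒴.ker_epi_closed K F X ⟨ModuleCat.ofHom (ULift.moduleEquiv.symm.toLinearMap ∘ₗ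
      (LinearMap.ker π).subtype ∘ₗ ULift.moduleEquiv.toLinearMap),
      ModuleCat.ofHom (π ∘ₗ ULift.moduleEquiv.toLinearMap), ?_, ?_, ?_⟩ hF hX
    · rintro ⟨a⟩ ⟨b⟩ h
      exact congrArg ULift.up (Subtype.ext (congrArg ULift.down h))
    · exact fun m => (hπ m).imp' ULift.up fun a ha => ha
    · rintro ⟨a⟩
      exact ⟨fun h => ⟨⟨⟨a, h⟩⟩, rfl⟩, by rintro ⟨⟨b⟩, h⟩; cases h; exact b.2⟩
  let j : LinearMap.ker π →ₗ[R] scaledPullback π x :=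
    (LinearMap.inl R (Fin n → R) X ∘ₗ (LinearMap.ker π).subtype).codRestrict _ fun a => by simp
  refine h𝒴.ext_closed K _ X ⟨ModuleCat.ofHom (j ∘ₗ ULift.moduleEquiv.toLinearMap),
    ModuleCat.ofHom (LinearMap.snd R _ X ∘ₗ (scaledPullback π x).subtype), ?_, ?_, ?_⟩ hK hX
  · rintro ⟨a⟩ ⟨b⟩ h
    exact congrArg ULift.up (Subtype.ext (congrArg (fun z => z.1.1) h))
  · intro m
    obtain ⟨a, ha⟩ := hπ (x • m)
    exact ⟨⟨(a, m), mem_scaledPullback.2 ha⟩, rfl⟩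
  · rintro ⟨⟨a, m⟩, ham⟩
    constructor
    · rintro rfl
      have ha : π a = 0 := (mem_scaledPullback.1 ham).trans (smul_zero x)
      exact ⟨⟨⟨a, ha⟩⟩, rfl⟩
    · rintro ⟨⟨b⟩, h⟩
      exact (congrArg (fun z => z.1.2) h).symm

variable [IsNoetherianRing R]

theorem mem_nonfreeLocus_iff (M : ModuleCat.{u} R) [Module.Finite R M] (p : PrimeSpectrum R) :
    p ∈ nonfreeLocus R M ↔ ∀ s ∉ p.asIdeal, ¬ FactorsThroughFree s M := by
  have : Module.FinitePresentation R M := Module.finitePresentation_of_finite R M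
  rw [nonfreeLocus, Set.mem_ofPred_eq, free_localizedModule_iff]
  push Not
  rfl

theorem nonfreeLocus_subset_of_isSummand {M N : ModuleCat.{u} R} [Module.Finite R M]
    [Module.Finite R N] (h : IsSummand R N M) : nonfreeLocus R N ⊆ nonfreeLocus R M := by
  obtain ⟨i, π, hi⟩ := h
  intro p hp
  rw [mem_nonfreeLocus_iff] at hp ⊢
  refine fun s hs hM => hp s hs (hM.of_retract i.hom π.hom fun x => ?_)
  exact congrArg (fun f => f.hom x) hi

theorem zeroLocus_subset_nonfreeLocus {M : ModuleCat.{u} R} [Module.Finite R M]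
    {p : PrimeSpectrum R} (hp : p ∈ nonfreeLocus R M) :
    PrimeSpectrum.zeroLocus (p.asIdeal : Set R) ⊆ nonfreeLocus R M := by
  intro q hq
  rw [mem_nonfreeLocus_iff] at hp ⊢
  exact fun s hs => hp s fun h => hs (hq h)

/-- Finitely generated modules form a resolving class. -/
theorem isResolving_finite : IsResolving R {M : ModuleCat.{u} R | Module.Finite R M} where
  finite _ h := h
  iso_closed _ _ := fun ⟨e⟩ h => have : Module.Finite R _ := h; Module.Finite.equiv e.toLinearEquiv
  proj_mem _ h _ := h
  summand_closed M N := fun ⟨i, π, hi⟩ (h : Module.Finite R M) =>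
    Module.Finite.of_surjective π.hom fun x => ⟨i.hom x, congrArg (fun f => f.hom x) hi⟩
  ext_closed L M N := fun ⟨f, g, _, hg, hfg⟩ (_ : Module.Finite R L) (_ : Module.Finite R N) => by
    have := isNoetherian_of_range_eq_ker f.hom g.hom (LinearMap.exact_iff.1 hfg).symm
    exact (inferInstance : Module.Finite R M)
  ker_epi_closed L M N := fun ⟨f, _, hf, _, _⟩ (_ : Module.Finite R M) _ =>
    Module.Finite.of_injective f.hom hf

theorem isResolving_resClosure {𝒳 : Set (ModuleCat.{u} R)} (h𝒳 : ∀ X ∈ 𝒳, Module.Finite R X) :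
    IsResolving R (resClosure R 𝒳) where
  finite _ hM := hM _ ⟨isResolving_finite, h𝒳⟩
  iso_closed M N e hM 𝒴 h𝒴 := h𝒴.1.iso_closed M N e (hM 𝒴 h𝒴)
  proj_mem M h h' _ h𝒴 := h𝒴.1.proj_mem M h h'
  summand_closed M N h hM 𝒴 h𝒴 := h𝒴.1.summand_closed M N h (hM 𝒴 h𝒴)
  ext_closed L M N h hL hN 𝒴 h𝒴 := h𝒴.1.ext_closed L M N h (hL 𝒴 h𝒴) (hN 𝒴 h𝒴)
  ker_epi_closed L M N h hM hN 𝒴 h𝒴 := h𝒴.1.ker_epi_closed L M N h (hM 𝒴 h𝒴) (hN 𝒴 h𝒴)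

theorem IsResolving.exists_nonfreeLocus_subset_zeroLocus {𝒴 : Set (ModuleCat.{u} R)}
    (h𝒴 : IsResolving R 𝒴) {X : ModuleCat.{u} R} (hX : X ∈ 𝒴) {p : PrimeSpectrum R}
    (hp : p ∈ nonfreeLocus R X) (T : Finset R) (hT : (T : Set R) ⊆ p.asIdeal) :
    ∃ Y ∈ 𝒴, p ∈ nonfreeLocus R Y ∧ nonfreeLocus R Y ⊆ PrimeSpectrum.zeroLocus T := by
  classical
  induction T using Finset.induction_on with
  | empty => exact ⟨X, hX, hp, by simp⟩
  | insert x T _ ih =>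
    rw [Finset.coe_insert, Set.insert_subset_iff] at hT
    obtain ⟨Y, hY, hpY, hYT⟩ := ih hT.2
    have := h𝒴.finite Y hY
    obtain ⟨n, π, hπ⟩ := Module.Finite.exists_fin' R Y
    have hZ := h𝒴.scaledPullback_mem hY π hπ x
    have := h𝒴.finite _ hZ
    refine ⟨_, hZ, ?_, fun q hq => ?_⟩
    · rw [mem_nonfreeLocus_iff] at hpY ⊢
      intro s hs h
      obtain ⟨t, ht, h⟩ := FactorsThroughFree.of_scaledPullback hT.1 hs π hπ h
      exact hpY t ht h
    · rw [mem_nonfreeLocus_iff] at hq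
      rw [Finset.coe_insert, PrimeSpectrum.mem_zeroLocus, Set.insert_subset_iff]
      refine ⟨?_, hYT ?_⟩
      · by_contra hx
        exact hq x hx (factorsThroughFree_scaledPullback π x)
      · rw [mem_nonfreeLocus_iff]
        intro s hs h
        exact hq (s * s) (fun h => hs (by simpa using q.2.mem_or_mem h))
          (h.scaledPullback π hπ x)

theorem IsResolving.exists_nonfreeLocus_eq_zeroLocus {𝒴 : Set (ModuleCat.{u} R)}
    (h𝒴 : IsResolving R 𝒴) {X : ModuleCat.{u} R} (hX : X ∈ 𝒴) {p : PrimeSpectrum R}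
    (hp : p ∈ nonfreeLocus R X) :
    ∃ Y ∈ 𝒴, nonfreeLocus R Y = PrimeSpectrum.zeroLocus (p.asIdeal : Set R) := by
  obtain ⟨T, hT⟩ := IsNoetherian.noetherian p.asIdeal
  obtain ⟨Y, hY, hpY, hYT⟩ := h𝒴.exists_nonfreeLocus_subset_zeroLocus hX hp T
    (hT ▸ Submodule.subset_span)
  have := h𝒴.finite Y hY
  refine ⟨Y, hY, subset_antisymm ?_ (zeroLocus_subset_nonfreeLocus hpY)⟩
  rw [← hT]
  exact hYT.trans (PrimeSpectrum.zeroLocus_span _).ge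

theorem exists_indec_summand {M : ModuleCat.{max u v} R} [Module.Finite R M]
    {p : PrimeSpectrum R} (hp : p ∈ nonfreeLocus R M) :
    ∃ N : ModuleCat.{max u v} R, Indec.{u, v} R N ∧ IsSummand R N M ∧ p ∈ nonfreeLocus R N := by
  suffices key : ∀ (K : Submodule R M) (N : ModuleCat.{max u v} R) (i : N →ₗ[R] M)
      (π : M →ₗ[R] N), (∀ x, π (i x) = x) → LinearMap.ker π = K → p ∈ nonfreeLocus R N →
      ∃ N : ModuleCat.{max u v} R, Indec.{u, v} R N ∧ IsSummand R N M ∧ p ∈ nonfreeLocus R N from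
    key _ M LinearMap.id LinearMap.id (fun _ => rfl) rfl hp
  intro K
  induction K using WellFoundedGT.induction with | _ K ih
  rintro N i π hi rfl hN
  have hπ : Function.Surjective π := fun x => ⟨i x, hi x⟩
  have : Module.Finite R N := .of_surjective π hπ
  by_cases hind : Indec.{u, v} R N
  · exact ⟨N, hind, ⟨ModuleCat.ofHom i, ModuleCat.ofHom π, by ext x; exact hi x⟩, hN⟩
  have descend : ∀ (A : Type (max u v)) [AddCommGroup A] [Module R A] (f : A →ₗ[R] N)
      (g : N →ₗ[R] A), (∀ a, g (f a) = a) → (∃ y, y ≠ 0 ∧ g y = 0) →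
      p ∈ nonfreeLocus R (ModuleCat.of R A) →
      ∃ N : ModuleCat.{max u v} R, Indec.{u, v} R N ∧ IsSummand R N M ∧
        p ∈ nonfreeLocus R N := by
    rintro A _ _ f g hfg ⟨y, hy, hgy⟩ hA
    refine ih (LinearMap.ker (g ∘ₗ π)) (lt_of_le_of_ne (LinearMap.ker_le_ker_comp _ _) fun h => ?_)
      (ModuleCat.of R A) (i ∘ₗ f) (g ∘ₗ π) (fun a => by simp [hi, hfg]) rfl hA
    have : i y ∈ LinearMap.ker (g ∘ₗ π) := by simp [hi, hgy]
    rw [← h, LinearMap.mem_ker, hi] at this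
    exact hy this
  have hnt : Nontrivial N := by
    by_contra h
    rw [not_nontrivial_iff_subsingleton] at h
    refine (mem_nonfreeLocus_iff N p).1 hN 1 p.2.one_notMem ⟨0, 0, 0, ?_⟩
    ext x
    exact Subsingleton.elim _ _
  obtain ⟨A, B, hA, hB, ⟨e⟩⟩ : ∃ (A : ModuleCat.{v} R) (B : ModuleCat.{u} R),
      Nontrivial A ∧ Nontrivial B ∧ Nonempty (N ≅ ModuleCat.of R (A × B)) := by
    by_contra! h
    exact hind ⟨hnt, fun A B hA hB => h A B hA hB⟩
  replace e : N ≃ₗ[R] A × B := e.toLinearEquiv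
  let eA : ULift.{u} A ≃ₗ[R] A := ULift.moduleEquiv
  let eB : ULift.{v} B ≃ₗ[R] B := ULift.moduleEquiv
  have : Module.Finite R (A × B) := .equiv e
  have : Module.Finite R A := .of_surjective (LinearMap.fst R A B) Prod.fst_surjective
  have : Module.Finite R B := .of_surjective (LinearMap.snd R A B) Prod.snd_surjective
  have : Module.Finite R (ULift.{u} A) := .equiv eA.symm
  have : Module.Finite R (ULift.{v} B) := .equiv eB.symm
  by_cases hpA : p ∈ nonfreeLocus R (ModuleCat.of R (ULift.{u} A))
  · obtain ⟨b, hb⟩ := exists_ne (0 : B)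
    exact descend (ULift.{u} A)
      (e.symm.toLinearMap ∘ₗ LinearMap.inl R A B ∘ₗ eA.toLinearMap)
      (eA.symm.toLinearMap ∘ₗ LinearMap.fst R A B ∘ₗ e.toLinearMap) (by simp)
      ⟨e.symm (0, b), by simpa using hb, by simp⟩ hpA
  by_cases hpB : p ∈ nonfreeLocus R (ModuleCat.of R (ULift.{v} B))
  · obtain ⟨a, ha⟩ := exists_ne (0 : A)
    exact descend (ULift.{v} B)
      (e.symm.toLinearMap ∘ₗ LinearMap.inr R A B ∘ₗ eB.toLinearMap)
      (eB.symm.toLinearMap ∘ₗ LinearMap.snd R A B ∘ₗ e.toLinearMap) (by simp)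
      ⟨e.symm (a, 0), by simpa using ha, by simp⟩ hpB
  rw [mem_nonfreeLocus_iff] at hpA hpB hN
  push Not at hpA hpB
  obtain ⟨s, hs, hsA⟩ := hpA
  obtain ⟨t, ht, htB⟩ := hpB
  refine absurd ?_ (hN (s * t) fun h => (p.2.mem_or_mem h).elim hs ht)
  exact (hsA.prod htB).of_retract ((eA.symm.prodCongr eB.symm).toLinearMap ∘ₗ e.toLinearMap)
    (e.symm.toLinearMap ∘ₗ (eA.prodCongr eB).toLinearMap) (by simp)

theorem countable_nonfreeLocusSet {𝒳 : Set (ModuleCat.{max u v} R)}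
    (h𝒳 : ∀ X ∈ 𝒳, Module.Finite R X) {S : Set (ModuleCat.{max u v} R)} (hS : S.Countable)
    (h : ∀ M ∈ resClosure R 𝒳, Indec.{u, v} R M → ∃ N ∈ S, Nonempty (M ≅ N)) :
    (nonfreeLocusSet R 𝒳).Countable := by
  have hres := isResolving_resClosure h𝒳
  have key : ∀ p ∈ nonfreeLocusSet R 𝒳,
      ∃ N ∈ S, nonfreeLocus R N = PrimeSpectrum.zeroLocus (p.asIdeal : Set R) := by
    intro p hp
    simp only [nonfreeLocusSet, Set.mem_iUnion] at hp
    obtain ⟨X, hX, hp⟩ := hp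
    obtain ⟨Y, hY, hYp⟩ :=
      hres.exists_nonfreeLocus_eq_zeroLocus (fun 𝒴 h𝒴 => h𝒴.2 hX) hp
    have := hres.finite Y hY
    have hpY : p ∈ nonfreeLocus R Y := hYp ▸ mem_zeroLocus_asIdeal p
    obtain ⟨Z, hZind, hZ, hpZ⟩ := exists_indec_summand.{u, v} hpY
    have hZmem := hres.summand_closed Y Z hZ hY
    have := hres.finite Z hZmem
    obtain ⟨N, hN, ⟨e⟩⟩ := h Z hZmem hZind
    have := hres.finite N (hres.iso_closed Z N ⟨e⟩ hZmem)
    refine ⟨N, hN, subset_antisymm ?_ (zeroLocus_subset_nonfreeLocus ?_)⟩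
    · exact hYp ▸ (nonfreeLocus_subset_of_isSummand ⟨e.inv, e.hom, e.inv_hom_id⟩).trans
        (nonfreeLocus_subset_of_isSummand hZ)
    · exact nonfreeLocus_subset_of_isSummand ⟨e.hom, e.inv, e.hom_inv_id⟩ hpZ
  choose! N hNS hN using key
  refine Set.MapsTo.countable_of_injOn (f := N) hNS (fun p hp q hq hpq => ?_) hS
  have heq : PrimeSpectrum.zeroLocus (p.asIdeal : Set R) =
      PrimeSpectrum.zeroLocus (q.asIdeal : Set R) := by
    rw [← hN p hp, ← hN q hq, hpq]
  refine le_antisymm (α := PrimeSpectrum R) ?_ ?_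
  · exact (heq ▸ mem_zeroLocus_asIdeal _ : q ∈ PrimeSpectrum.zeroLocus (p.asIdeal : Set R))
  · exact (heq ▸ mem_zeroLocus_asIdeal _ : p ∈ PrimeSpectrum.zeroLocus (q.asIdeal : Set R))

end Resolving

/-- If `R` is noetherian local and complete or with uncountable
residue field, and the resolving closure of `𝒳` contains only countably many
indecomposable modules up to isomorphism, then `dim NF(𝒳) ≤ 1`. -/
theorem stmt18 (R : Type) [CommRing R] [IsNoetherianRing R] [IsLocalRing R]
    (hR : IsAdicComplete (IsLocalRing.maximalIdeal R) R ∨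
      Uncountable (IsLocalRing.ResidueField R))
    (𝒳 : Set (ModuleCat R)) (h𝒳 : ∀ X ∈ 𝒳, Module.Finite R X)
    (hcount : ∃ S : Set (ModuleCat R), S.Countable ∧
      ∀ M ∈ resClosure R 𝒳, Indec R M → ∃ N ∈ S, Nonempty (M ≅ N)) :
    dimSet R (nonfreeLocusSet R 𝒳) ≤ 1 := by
  obtain ⟨S, hS, h⟩ := hcount
  have hc := countable_nonfreeLocusSet h𝒳 hS h
  refine iSup₂_le fun p hp => ringKrullDim_quotient_le_one_of_countable_zeroLocus hR p.asIdeal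
    (hc.mono ?_)
  simp only [nonfreeLocusSet, Set.mem_iUnion] at hp
  obtain ⟨X, hX, hp⟩ := hp
  have := h𝒳 X hX
  exact (zeroLocus_subset_nonfreeLocus hp).trans (Set.subset_biUnion_of_mem hX)
end

section
/- Let R be a Cohen-Macaulay commutative noetherian local ring with residue field k, and assume either that R is complete (m-adically complete, where m is the maximal ideal) or that k is uncountable. If R has countable Cohen-Macaulay representation type, i.e., there are at most countably many isomorphism classes of indecomposable maximal Cohen-Macaulay R-modules, then dim Sing R ≤ 1. -/
open CategoryTheory

open RingTheory.Sequence Abelian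

section RegularSequences

variable {R : Type*} [CommRing R]

lemma QuotSMulTop.map_injective_of_exact {K F N : Type*} [AddCommGroup K] [Module R K]
    [AddCommGroup F] [Module R F] [AddCommGroup N] [Module R N]
    {f : K →ₗ[R] F} {g : F →ₗ[R] N} (hf : Function.Injective f) (hfg : Function.Exact f g)
    {r : R} (hr : IsSMulRegular N r) : Function.Injective (QuotSMulTop.map r f) := by
  rw [injective_iff_map_eq_zero]
  intro a
  obtain ⟨m, rfl⟩ := Submodule.Quotient.mk_surjective _ a
  intro h
  rw [QuotSMulTop.map_apply_mk, Submodule.Quotient.mk_eq_zero,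
    Submodule.mem_smul_pointwise_iff_exists] at h
  obtain ⟨n, -, hn⟩ := h
  have hgn : g n = 0 := hr.right_eq_zero_of_smul (by
    rw [← map_smul, hn, hfg.apply_apply_eq_zero])
  obtain ⟨k, rfl⟩ := (hfg n).1 hgn
  rw [← map_smul] at hn
  rw [Submodule.Quotient.mk_eq_zero, ← hf hn]
  exact Submodule.smul_mem_pointwise_smul _ _ _ trivial

/-- The depth lemma for kernels of surjections, in terms of a fixed regular sequence. -/
lemma RingTheory.Sequence.IsWeaklyRegular.take_succ_of_exact (n : ℕ) (rs : List R)
    {K F N : Type*} [AddCommGroup K] [Module R K]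
    [AddCommGroup F] [Module R F] [AddCommGroup N] [Module R N]
    {f : K →ₗ[R] F} {g : F →ₗ[R] N} (hf : Function.Injective f) (hg : Function.Surjective g)
    (hfg : Function.Exact f g) (hN : IsWeaklyRegular N (rs.take n))
    (hF : IsWeaklyRegular F (rs.take (n + 1))) : IsWeaklyRegular K (rs.take (n + 1)) := by
  induction n generalizing rs K F N with
  | zero =>
    cases rs with
    | nil => simp
    | cons r rs =>
      simp only [zero_add, List.take_succ_cons, List.take_zero, isWeaklyRegular_singleton_iff]
        at hF ⊢
      exact hF.of_injective f hf
  | succ n ih =>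
    cases rs with
    | nil => simp
    | cons r rs =>
      rw [List.take_succ_cons, isWeaklyRegular_cons_iff] at hN hF ⊢
      exact ⟨hF.1.of_injective f hf, ih rs (QuotSMulTop.map_injective_of_exact hf hfg hN.1)
        (QuotSMulTop.map_surjective r hg) (QuotSMulTop.map_exact r hfg hg) hN.2 hF.2⟩

lemma RingTheory.Sequence.IsWeaklyRegular.of_retract (rs : List R) {M N : Type*} [AddCommGroup M]
    [Module R M] [AddCommGroup N] [Module R N] (i : N →ₗ[R] M) (π : M →ₗ[R] N)
    (h : π ∘ₗ i = LinearMap.id) (hM : IsWeaklyRegular M rs) : IsWeaklyRegular N rs := by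
  induction rs generalizing M N with
  | nil => simp
  | cons r rs ih =>
    rw [isWeaklyRegular_cons_iff] at hM ⊢
    refine ⟨hM.1.of_injective i (LinearMap.injective_of_comp_eq_id _ _ h),
      ih (QuotSMulTop.map r i) (QuotSMulTop.map r π) ?_ hM.2⟩
    rw [← QuotSMulTop.map_comp, h, QuotSMulTop.map_id]

lemma RingTheory.Sequence.IsWeaklyRegular.fin_fun (rs : List R) (k : ℕ)
    (h : IsWeaklyRegular R rs) : IsWeaklyRegular (Fin k → R) rs := by
  have := h.isWeaklyRegular_lTensor (M₂ := Fin k → R)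
  exact ((TensorProduct.rid R (Fin k → R)).isWeaklyRegular_congr rs).1 this

end RegularSequences

section Syzygies

variable {R : Type} [CommRing R]

lemma shortExact_of_linearMap {K F N : Type} [AddCommGroup K] [Module R K]
    [AddCommGroup F] [Module R F] [AddCommGroup N] [Module R N]
    {f : K →ₗ[R] F} {g : F →ₗ[R] N} (hf : Function.Injective f) (hg : Function.Surjective g)
    (hfg : Function.Exact f g) :
    (ModuleCat.shortComplexOfCompEqZero f g hfg.linearMap_comp_eq_zero).ShortExact :=
  { exact := ModuleCat.shortComplex_exact _ hfg
    mono_f := by simpa [ModuleCat.mono_iff_injective] using! hf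
    epi_g := by simpa [ModuleCat.epi_iff_surjective] using! hg }

lemma hasProjectiveDimensionLE_succ_iff_of_exact {K F N : Type} [AddCommGroup K] [Module R K]
    [AddCommGroup F] [Module R F] [AddCommGroup N] [Module R N] [Module.Projective R F]
    {f : K →ₗ[R] F} {g : F →ₗ[R] N} (hf : Function.Injective f) (hg : Function.Surjective g)
    (hfg : Function.Exact f g) (n : ℕ) :
    HasProjectiveDimensionLE (ModuleCat.of R N) (n + 1) ↔
      HasProjectiveDimensionLE (ModuleCat.of R K) n := by
  exact (shortExact_of_linearMap hf hg hfg).hasProjectiveDimensionLT_X₃_iff n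
    ((IsProjective.iff_projective F).1 inferInstance)

lemma exists_syzygy [IsNoetherianRing R] (n : ℕ) (N : Type) [AddCommGroup N] [Module R N]
    [Module.Finite R N] :
    ∃ (K : Type) (_ : AddCommGroup K) (_ : Module R K), Module.Finite R K ∧
      (∀ rs : List R, IsWeaklyRegular R rs → IsWeaklyRegular K (rs.take n)) ∧
      ∀ (p : PrimeSpectrum R) (j : ℕ),
        HasProjectiveDimensionLE (ModuleCat.of (Localization.AtPrime p.asIdeal)
          (LocalizedModule p.asIdeal.primeCompl N)) (n + j) ↔
        HasProjectiveDimensionLE (ModuleCat.of (Localization.AtPrime p.asIdeal)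
          (LocalizedModule p.asIdeal.primeCompl K)) j := by
  induction n with
  | zero => exact ⟨N, _, _, inferInstance, by simp, fun p j ↦ by rw [zero_add]⟩
  | succ n ih =>
    obtain ⟨K, _, _, _, hreg, hpd⟩ := ih
    obtain ⟨k, g, hg⟩ := Module.Finite.exists_fin' R K
    have hex : Function.Exact (LinearMap.ker g).subtype g := LinearMap.exact_subtype_ker_map g
    refine ⟨LinearMap.ker g, _, _, inferInstance, fun rs hrs ↦ ?_, fun p j ↦ ?_⟩
    · refine IsWeaklyRegular.take_succ_of_exact n rs (Submodule.injective_subtype _) hg hex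
        (hreg rs hrs) (IsWeaklyRegular.fin_fun _ k ?_)
      have := hrs
      rw [← List.take_append_drop (n + 1) rs, isWeaklyRegular_append_iff] at this
      exact this.1
    · rw [add_assoc, add_comm 1 j, hpd p (j + 1)]
      let S := p.asIdeal.primeCompl
      exact hasProjectiveDimensionLE_succ_iff_of_exact
        (f := LocalizedModule.map S (LinearMap.ker g).subtype) (g := LocalizedModule.map S g)
        (LocalizedModule.map_injective S _ (Submodule.injective_subtype _))
        (LocalizedModule.map_surjective S _ hg) (LocalizedModule.map_exact S _ _ hex) j

lemma hasProjectiveDimensionLE_zero_iff_free [IsLocalRing R] (N : Type) [AddCommGroup N]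
    [Module R N] [Module.Finite R N] [IsNoetherianRing R] :
    HasProjectiveDimensionLE (ModuleCat.of R N) 0 ↔ Module.Free R N := by
  rw [← projective_iff_hasProjectiveDimensionLE_zero, ← IsProjective.iff_projective]
  exact ⟨fun _ ↦ Module.free_of_flat_of_isLocalRing, fun _ ↦ inferInstance⟩

end Syzygies

section ExtInduction

variable {A : Type} [CommRing A]

/-- The sequence `0 → A/(I : x) → A/I → A/(I + xA) → 0` is short exact. -/
lemma exists_shortExact_colon (I J : Ideal A) (x : A) (hJ : ∀ a, a ∈ J ↔ x * a ∈ I) :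
    ∃ (f : A ⧸ J →ₗ[A] A ⧸ I) (g : A ⧸ I →ₗ[A] A ⧸ (I ⊔ Ideal.span {x})),
      (∀ a, f (Submodule.Quotient.mk a) = Submodule.Quotient.mk (x * a)) ∧
      Function.Injective f ∧ Function.Surjective g ∧ Function.Exact f g := by
  let f : A ⧸ J →ₗ[A] A ⧸ I := Submodule.mapQ J I (LinearMap.lsmul A A x) fun a ha ↦ (hJ a).1 ha
  let g : A ⧸ I →ₗ[A] A ⧸ (I ⊔ Ideal.span {x}) := Submodule.factor le_sup_left
  refine ⟨f, g, fun _ ↦ rfl, ?_, Submodule.factor_surjective _, fun b ↦ ?_⟩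
  · rw [injective_iff_map_eq_zero]
    intro a
    obtain ⟨a, rfl⟩ := Submodule.Quotient.mk_surjective _ a
    intro h
    rw [Submodule.Quotient.mk_eq_zero, hJ]
    exact (Submodule.Quotient.mk_eq_zero I).1 h
  · obtain ⟨b, rfl⟩ := Submodule.Quotient.mk_surjective _ b
    have hb : g (Submodule.Quotient.mk b) = 0 ↔ b ∈ I ⊔ Ideal.span {x} :=
      Submodule.Quotient.mk_eq_zero _
    rw [hb]
    constructor
    · intro h
      obtain ⟨y, hy, z, hz, rfl⟩ := Submodule.mem_sup.1 h
      obtain ⟨c, rfl⟩ := Ideal.mem_span_singleton'.1 hz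
      refine ⟨Submodule.Quotient.mk c, ?_⟩
      change Submodule.Quotient.mk (x * c) = _
      rw [Submodule.Quotient.eq]
      convert neg_mem hy using 1
      ring
    · rintro ⟨c, hc⟩
      obtain ⟨c, rfl⟩ := Submodule.Quotient.mk_surjective _ c
      change Submodule.Quotient.mk (x * c) = _ at hc
      rw [eq_comm, Submodule.Quotient.eq] at hc
      have := Submodule.mem_sup.2 ⟨_, hc, x * c,
        Ideal.mem_span_singleton'.2 ⟨c, mul_comm _ _⟩, rfl⟩
      simpa using this

lemma subsingleton_ext_quotient [IsNoetherianRing A] [IsLocalRing A] (N : ModuleCat.{0} A)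
    [Module.Finite A N] (n : ℕ)
    (h : ∀ i, n ≤ i → Subsingleton
      (Ext (ModuleCat.of A (A ⧸ IsLocalRing.maximalIdeal A)) N i)) (I : Ideal A) :
    ∀ i, n ≤ i → Subsingleton (Ext (ModuleCat.of A (A ⧸ I)) N i) := by
  induction I using IsNoetherian.induction with
  | hgt I ih =>
  intro i hi
  by_cases htop : I = ⊤
  · subst htop
    have : Subsingleton (A ⧸ (⊤ : Ideal A)) := Ideal.Quotient.subsingleton_iff.2 rfl
    have hz : Limits.IsZero (ModuleCat.of A (A ⧸ (⊤ : Ideal A))) :=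
      ModuleCat.isZero_of_subsingleton _
    exact ⟨fun a b ↦ (hz.hasProjectiveDimensionLT_zero.subsingleton _ 0 i
      (Nat.zero_le i) N).elim a b⟩
  by_cases hp : Ideal.IsPrime I
  · by_cases hm : I = IsLocalRing.maximalIdeal A
    · subst hm
      exact h i hi
    obtain ⟨x, hxm, hxI⟩ := SetLike.exists_of_lt
      (lt_of_le_of_ne (IsLocalRing.le_maximalIdeal htop) hm)
    obtain ⟨f, g, hfx, hf, hg, hfg⟩ := exists_shortExact_colon I I x fun a ↦
      ⟨fun ha ↦ Ideal.mul_mem_left I _ ha, fun ha ↦ (hp.mem_or_mem ha).resolve_left hxI⟩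
    have hS := shortExact_of_linearMap hf hg hfg
    have hlt : I < I ⊔ Ideal.span {x} := lt_of_le_of_ne le_sup_left fun he ↦ hxI (by
      rw [he]
      exact Ideal.mem_sup_right (Ideal.mem_span_singleton_self x))
    have hz := ih _ hlt (i + 1) (by omega)
    have hfs : ModuleCat.ofHom f = x • 𝟙 (ModuleCat.of A (A ⧸ I)) := by
      refine ModuleCat.hom_ext (LinearMap.ext fun a ↦ ?_)
      obtain ⟨a, rfl⟩ := Submodule.Quotient.mk_surjective _ a
      exact hfx a
    by_contra hns
    rw [not_subsingleton_iff_nontrivial] at hns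
    have hj : x ∈ (Module.annihilator A (Ext (ModuleCat.of A (A ⧸ I)) N i)).jacobson :=
      IsLocalRing.maximalIdeal_le_jacobson _ hxm
    refine Submodule.top_ne_pointwise_smul_of_mem_jacobson_annihilator hj ?_
    rw [eq_comm, eq_top_iff]
    intro e _
    obtain ⟨e', he'⟩ := Ext.contravariant_sequence_exact₁ hS N e (add_comm 1 i) (hz.elim _ _)
    change (Ext.mk₀ (ModuleCat.ofHom f)).comp e' (zero_add i) = e at he'
    rw [hfs, Ext.mk₀_smul, Ext.smul_comp, Ext.mk₀_id_comp] at he'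
    rw [← he']
    exact Submodule.smul_mem_pointwise_smul _ _ _ trivial
  · obtain ⟨x, y, hxy, hx, hy⟩ : ∃ x y, x * y ∈ I ∧ x ∉ I ∧ y ∉ I := by
      by_contra! hcon
      exact hp ⟨htop, fun {a b} hab ↦ or_iff_not_imp_left.2 fun ha ↦ hcon a b hab ha⟩
    let J : Ideal A := I.comap (LinearMap.lsmul A A x)
    obtain ⟨f, g, -, hf, hg, hfg⟩ := exists_shortExact_colon I J x fun a ↦ Iff.rfl
    have hS := shortExact_of_linearMap hf hg hfg
    have hlt : I < I ⊔ Ideal.span {x} := lt_of_le_of_ne le_sup_left fun he ↦ hx (by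
      rw [he]
      exact Ideal.mem_sup_right (Ideal.mem_span_singleton_self x))
    have hlt' : I < J := lt_of_le_of_ne (fun a ha ↦ Ideal.mul_mem_left I x ha) fun he ↦ hy (by
      rw [he]
      exact hxy)
    have h₁ := ih _ hlt' i hi
    have h₃ := ih _ hlt i hi
    refine subsingleton_of_forall_eq 0 fun e ↦ ?_
    obtain ⟨e', rfl⟩ := Ext.contravariant_sequence_exact₂ hS N e (h₁.elim _ _)
    rw [h₃.elim e' 0, Ext.comp_zero]

/-- Over a noetherian local ring, the projective dimension of the residue field bounds that of
every cyclic module. -/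
lemma hasProjectiveDimensionLT_quotient_of_residueField [IsNoetherianRing A] [IsLocalRing A]
    (n : ℕ) [HasProjectiveDimensionLT (ModuleCat.of A (A ⧸ IsLocalRing.maximalIdeal A)) n]
    (I : Ideal A) : HasProjectiveDimensionLT (ModuleCat.of A (A ⧸ I)) n := by
  have hf : Module.Finite A (ModuleCat.of A (A ⧸ I)) := inferInstanceAs (Module.Finite A (A ⧸ I))
  exact ModuleCat.hasProjectiveDimensionLT_of_forall_finite _ n fun L _ ↦
    subsingleton_ext_quotient L n (fun i hi ↦ HasProjectiveDimensionLT.subsingleton _ n i hi L)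
      I n le_rfl

/-- If the socle of `A` is nonzero and the residue field has finite projective dimension, then the
residue field is projective. -/
lemma projective_residueField_of_socle [IsNoetherianRing A] [IsLocalRing A] (s : A)
    (hs : ∀ a, a ∈ IsLocalRing.maximalIdeal A ↔ s * a = 0) (n : ℕ)
    (h : HasProjectiveDimensionLE (ModuleCat.of A (A ⧸ IsLocalRing.maximalIdeal A)) n) :
    HasProjectiveDimensionLE (ModuleCat.of A (A ⧸ IsLocalRing.maximalIdeal A)) 0 := by
  induction n with
  | zero => exact h
  | succ n ih =>
    apply ih
    obtain ⟨f, g, -, hf, hg, hfg⟩ := exists_shortExact_colon ⊥ (IsLocalRing.maximalIdeal A) s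
      (by simpa using hs)
    have hS := shortExact_of_linearMap hf hg hfg
    have hP : Projective (ModuleCat.of A (A ⧸ (⊥ : Ideal A))) := by
      rw [← IsProjective.iff_projective]
      exact Module.Projective.of_equiv
        (Submodule.quotEquivOfEqBot (⊥ : Submodule A A) rfl).symm
    exact (hS.hasProjectiveDimensionLT_X₃_iff n hP).1
      (hasProjectiveDimensionLT_quotient_of_residueField (n + 2) _)

end ExtInduction

section Serre

variable {A : Type} [CommRing A]

lemma hasProjectiveDimensionLE_quotSMulTop [IsNoetherianRing A] {x : A} (hx : IsSMulRegular A x)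
    (n : ℕ) (M : Type) [AddCommGroup M] [Module A M] [Module.Finite A M]
    (hM : IsSMulRegular M x) (h : HasProjectiveDimensionLE (ModuleCat.of A M) n) :
    HasProjectiveDimensionLE (ModuleCat.of (A ⧸ Ideal.span {x}) (QuotSMulTop x M)) n := by
  induction n generalizing M with
  | zero =>
    rw [← projective_iff_hasProjectiveDimensionLE_zero, ← IsProjective.iff_projective] at h ⊢
    exact Module.Projective.of_equiv ((QuotSMulTop.equivQuotTensor x M).extendScalarsOfSurjective
      Ideal.Quotient.mk_surjective).symm
  | succ n ih =>
    obtain ⟨k, g, hg⟩ := Module.Finite.exists_fin' A M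
    have hex : Function.Exact (LinearMap.ker g).subtype g := LinearMap.exact_subtype_ker_map g
    have hF : IsSMulRegular (Fin k → A) x := IsSMulRegular.pi fun _ ↦ hx
    have hK := ih (LinearMap.ker g) (hF.of_injective _ (Submodule.injective_subtype _))
      ((hasProjectiveDimensionLE_succ_iff_of_exact (Submodule.injective_subtype _) hg hex n).1 h)
    have hsurj : Function.Surjective (algebraMap A (A ⧸ Ideal.span {x})) :=
      Ideal.Quotient.mk_surjective
    exact (hasProjectiveDimensionLE_succ_iff_of_exact
      (f := LinearMap.extendScalarsOfSurjectiveEquiv hsurj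
        (QuotSMulTop.map x (LinearMap.ker g).subtype))
      (g := LinearMap.extendScalarsOfSurjectiveEquiv hsurj (QuotSMulTop.map x g))
      (QuotSMulTop.map_injective_of_exact (Submodule.injective_subtype _) hex hM)
      (QuotSMulTop.map_surjective x hg) (QuotSMulTop.map_exact x hex hg) n).2 hK

lemma exists_linearMap_maximalIdeal_apply_eq_one [IsLocalRing A] {x : A}
    (hx : x ∈ IsLocalRing.maximalIdeal A) (hx2 : x ∉ IsLocalRing.maximalIdeal A ^ 2) :
    ∃ φ : IsLocalRing.maximalIdeal A →ₗ[A] A ⧸ IsLocalRing.maximalIdeal A, φ ⟨x, hx⟩ = 1 := by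
  have hne : ((IsLocalRing.maximalIdeal A).toCotangent ⟨x, hx⟩ :
      IsLocalRing.CotangentSpace A) ≠ 0 := fun h ↦
    hx2 ((Ideal.toCotangent_eq_zero _ _).1 h)
  obtain ⟨f, hf⟩ := Module.Projective.exists_dual_eq_one (IsLocalRing.ResidueField A) hne
  exact ⟨(f.restrictScalars A).comp (IsLocalRing.maximalIdeal A).toCotangent, hf⟩

/-- For `x ∈ 𝔪 \ 𝔪²`, the residue field is a direct summand of `𝔪 / x𝔪` over `A / xA`. -/
lemma hasProjectiveDimensionLE_residueField_quotient [IsNoetherianRing A] [IsLocalRing A]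
    {x : A} (hx : x ∈ IsLocalRing.maximalIdeal A) (hx2 : x ∉ IsLocalRing.maximalIdeal A ^ 2)
    (hreg : IsSMulRegular A x) [IsLocalRing (A ⧸ Ideal.span {x})] (n : ℕ)
    (h : HasProjectiveDimensionLE (ModuleCat.of A (A ⧸ IsLocalRing.maximalIdeal A)) n) :
    HasProjectiveDimensionLE (ModuleCat.of (A ⧸ Ideal.span {x})
      ((A ⧸ Ideal.span {x}) ⧸ IsLocalRing.maximalIdeal (A ⧸ Ideal.span {x}))) n := by
  set B := A ⧸ Ideal.span {x} with hB
  let m := IsLocalRing.maximalIdeal A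
  let mB := IsLocalRing.maximalIdeal B
  have hsurj : Function.Surjective (algebraMap A B) := Ideal.Quotient.mk_surjective
  have hcomap (a : A) : algebraMap A B a ∈ mB ↔ a ∈ m := by
    have hl : IsLocalHom (algebraMap A B) := IsLocalHom.of_surjective _ hsurj
    rw [IsLocalRing.mem_maximalIdeal, IsLocalRing.mem_maximalIdeal, mem_nonunits_iff,
      mem_nonunits_iff, isUnit_map_iff]
  have hm : HasProjectiveDimensionLE (ModuleCat.of A m) n :=
    (hasProjectiveDimensionLE_succ_iff_of_exact (f := m.subtype) (g := m.mkQ)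
      (Submodule.injective_subtype _) (Submodule.mkQ_surjective _)
      (LinearMap.exact_subtype_mkQ m) n).1
      (hasProjectiveDimensionLT_of_ge _ (n + 1) _ (by omega))
  have hq : HasProjectiveDimensionLE (ModuleCat.of B (QuotSMulTop x m)) n :=
    hasProjectiveDimensionLE_quotSMulTop hreg n m
      (hreg.of_injective _ (Submodule.injective_subtype m)) hm
  obtain ⟨φ, hφ⟩ := exists_linearMap_maximalIdeal_apply_eq_one hx hx2
  let q : A ⧸ m →ₗ[A] B ⧸ mB := Submodule.liftQ m
    ((Submodule.mkQ mB).restrictScalars A ∘ₗ Algebra.linearMap A B) fun a ha ↦ by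
      rw [LinearMap.mem_ker]
      exact (Submodule.Quotient.mk_eq_zero _).2 ((hcomap a).2 ha)
  let π₀ : QuotSMulTop x m →ₗ[A] B ⧸ mB := Submodule.liftQ _ (q ∘ₗ φ) fun y hy ↦ by
    obtain ⟨y, -, rfl⟩ := (Submodule.mem_smul_pointwise_iff_exists _ _ _).1 hy
    obtain ⟨b, hb⟩ := Submodule.Quotient.mk_surjective _ (φ y)
    rw [LinearMap.mem_ker, LinearMap.comp_apply, map_smul, ← hb, ← Submodule.Quotient.mk_smul]
    have : (Submodule.Quotient.mk (x • b) : A ⧸ m) = 0 :=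
      (Submodule.Quotient.mk_eq_zero _).2 (m.mul_mem_right _ hx)
    rw [this, map_zero]
  let π : QuotSMulTop x m →ₗ[B] B ⧸ mB := LinearMap.extendScalarsOfSurjectiveEquiv hsurj π₀
  let i : B ⧸ mB →ₗ[B] QuotSMulTop x m := Submodule.liftQ mB
    (LinearMap.toSpanSingleton B _ (Submodule.Quotient.mk ⟨x, hx⟩)) fun b hb ↦ by
      obtain ⟨a, rfl⟩ := hsurj b
      rw [LinearMap.mem_ker, LinearMap.toSpanSingleton_apply, algebraMap_smul,
        ← Submodule.Quotient.mk_smul, Submodule.Quotient.mk_eq_zero]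
      have : a • (⟨x, hx⟩ : m) = x • (⟨a, (hcomap a).1 hb⟩ : m) :=
        Subtype.ext (mul_comm a x)
      rw [this]
      exact Submodule.smul_mem_pointwise_smul _ _ _ trivial
  have hπi : π ∘ₗ i = LinearMap.id := by
    refine Submodule.linearMap_qext _ (LinearMap.ext_ring ?_)
    change π (i (Submodule.Quotient.mk 1)) = Submodule.Quotient.mk 1
    have hi : i (Submodule.Quotient.mk 1) = Submodule.Quotient.mk ⟨x, hx⟩ := by
      change (1 : B) • (Submodule.Quotient.mk ⟨x, hx⟩ : QuotSMulTop x m) = _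
      exact one_smul B _
    rw [hi]
    change q (φ ⟨x, hx⟩) = _
    rw [hφ]
    change Submodule.Quotient.mk (algebraMap A B 1) = _
    rw [map_one]
  let r : Retract (ModuleCat.of B (B ⧸ mB)) (ModuleCat.of B (QuotSMulTop x m)) :=
    { i := ModuleCat.ofHom i
      r := ModuleCat.ofHom π
      retract := by rw [← ModuleCat.ofHom_comp, hπi]; rfl }
  exact r.hasProjectiveDimensionLT (n + 1)

lemma IsRegularLocalRing.of_quotient_span_singleton [IsNoetherianRing A] [IsLocalRing A] {x : A}
    (hx : x ∈ IsLocalRing.maximalIdeal A) (hreg : IsSMulRegular A x)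
    [IsRegularLocalRing (A ⧸ Ideal.span {x})] : IsRegularLocalRing A := by
  classical
  set B := A ⧸ Ideal.span {x} with hB
  have hsurj : Function.Surjective (Ideal.Quotient.mk (Ideal.span {x})) :=
    Ideal.Quotient.mk_surjective
  obtain ⟨s, hs, hspan⟩ := Submodule.FG.exists_span_finset_card_eq_spanFinrank
    (IsNoetherian.noetherian (IsLocalRing.maximalIdeal B))
  obtain ⟨g, hg⟩ := hsurj.hasRightInverse
  have hm : IsLocalRing.maximalIdeal A = Ideal.span (insert x (s.image g) : Finset A) := by
    have hcomap : (IsLocalRing.maximalIdeal B).comap (Ideal.Quotient.mk (Ideal.span {x})) =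
        IsLocalRing.maximalIdeal A := by
      have := IsLocalHom.of_surjective _ hsurj
      exact ((IsLocalRing.local_hom_TFAE (Ideal.Quotient.mk (Ideal.span {x}))).out 0 4).1 this
    have hmap : IsLocalRing.maximalIdeal B =
        (Ideal.span (s.image g : Set A)).map (Ideal.Quotient.mk (Ideal.span {x})) := by
      rw [Ideal.map_span, ← hspan, Finset.coe_image, ← Set.image_comp, hg.comp_eq_id, Set.image_id]
    rw [← hcomap, hmap, Ideal.comap_map_of_surjective' _ hsurj, Ideal.mk_ker, Finset.coe_insert,
      Ideal.span_insert, sup_comm]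
  have hle : (IsLocalRing.maximalIdeal A).spanFinrank ≤
      (IsLocalRing.maximalIdeal B).spanFinrank + 1 := by
    rw [hm, ← hs]
    refine (Submodule.spanFinrank_span_le_ncard_of_finite (Finset.finite_toSet _)).trans ?_
    rw [Set.ncard_coe_finset]
    exact (Finset.card_insert_le _ _).trans (Nat.succ_le_succ Finset.card_image_le)
  apply IsRegularLocalRing.of_spanFinrank_maximalIdeal_le
  rw [← ringKrullDim_quotient_span_singleton_succ_eq_ringKrullDim hreg hx,
    ← IsRegularLocalRing.spanFinrank_maximalIdeal]
  exact_mod_cast hle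

lemma exists_isSMulRegular_notMem_sq [IsNoetherianRing A] [IsLocalRing A]
    (h : IsLocalRing.maximalIdeal A ∉ associatedPrimes A A) :
    ∃ x ∈ IsLocalRing.maximalIdeal A, x ∉ IsLocalRing.maximalIdeal A ^ 2 ∧ IsSMulRegular A x := by
  classical
  by_contra! hcon
  have hfin := associatedPrimes.finite A A
  let m := IsLocalRing.maximalIdeal A
  have hsub : (m : Set A) ⊆
      ⋃ i ∈ ((insert (m ^ 2) hfin.toFinset : Finset (Ideal A)) : Set (Ideal A)), (i : Set A) := by
    intro x hx
    by_cases hx2 : x ∈ m ^ 2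
    · exact Set.mem_biUnion (by simp) hx2
    · have hz : x ∈ ⋃ p ∈ associatedPrimes A A, (p : Set A) := by
        rw [biUnion_associatedPrimes_eq_compl_regular]
        exact hcon x hx hx2
      obtain ⟨p, hp, hxp⟩ := Set.mem_iUnion₂.1 hz
      exact Set.mem_biUnion (by simp [hp]) hxp
  obtain ⟨p, hp, hle⟩ := (Ideal.subset_union_prime (f := id) (m ^ 2) (m ^ 2) (fun i hi hi' _ ↦ by
    have hi : i ∈ associatedPrimes A A := by simpa [hi'] using hi
    exact hi.isPrime)).1 hsub
  rcases Finset.mem_insert.1 hp with rfl | hp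
  · have hbot : m = ⊥ := Submodule.eq_bot_of_le_smul_of_le_jacobson_bot m m
      (IsNoetherian.noetherian m) (by simpa [pow_two] using hle)
      (IsLocalRing.maximalIdeal_le_jacobson _)
    obtain ⟨p, hp⟩ := associatedPrimes.nonempty A A
    have : p = m := by
      have := IsLocalRing.le_maximalIdeal hp.isPrime.ne_top
      exact le_antisymm this (by rw [hbot]; exact bot_le)
    exact h (show m ∈ associatedPrimes A A by rw [← this]; exact hp)
  · have hp : p ∈ associatedPrimes A A := by simpa using hp
    have : p = m := le_antisymm (IsLocalRing.le_maximalIdeal hp.isPrime.ne_top) hle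
    exact h (show m ∈ associatedPrimes A A by rw [← this]; exact hp)

lemma IsLocalRing.exists_ringKrullDim_eq_natCast (A : Type*) [CommRing A] [IsNoetherianRing A]
    [IsLocalRing A] : ∃ d : ℕ, ringKrullDim A = d := by
  obtain ⟨d, hd⟩ := ENat.ne_top_iff_exists.1
    (Ideal.height_ne_top (IsLocalRing.maximalIdeal.isMaximal A).ne_top)
  exact ⟨d, by rw [← IsLocalRing.maximalIdeal_height_eq_ringKrullDim, ← hd]; rfl⟩

/-- Serre's criterion: a noetherian local ring whose residue field has finite projective dimension
is regular. -/
theorem isRegularLocalRing_of_hasProjectiveDimensionLE [IsNoetherianRing A] [IsLocalRing A]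
    (n : ℕ) (h : HasProjectiveDimensionLE (ModuleCat.of A (A ⧸ IsLocalRing.maximalIdeal A)) n) :
    IsRegularLocalRing A := by
  obtain ⟨d, hd⟩ := IsLocalRing.exists_ringKrullDim_eq_natCast A
  induction d using Nat.strong_induction_on generalizing A with
  | _ d ih =>
  by_cases hass : IsLocalRing.maximalIdeal A ∈ associatedPrimes A A
  · obtain ⟨-, s, hs⟩ := (isAssociatedPrime_iff ..).1 hass
    have h0 := projective_residueField_of_socle s (fun a ↦ by
      rw [hs, Submodule.mem_colon_singleton]
      simp [mul_comm]) n h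
    rw [hasProjectiveDimensionLE_zero_iff_free] at h0
    have : Nontrivial (A ⧸ IsLocalRing.maximalIdeal A) :=
      Ideal.Quotient.nontrivial_iff.2 Ideal.IsPrime.ne_top'
    have hbot : IsLocalRing.maximalIdeal A = ⊥ := by
      rw [← Ideal.annihilator_quotient (I := IsLocalRing.maximalIdeal A)]
      exact Module.annihilator_eq_bot.2 inferInstance
    apply IsRegularLocalRing.of_spanFinrank_maximalIdeal_le
    rw [hbot, Submodule.spanFinrank_bot]
    exact_mod_cast ringKrullDim_nonneg_of_nontrivial
  obtain ⟨x, hx, hx2, hreg⟩ := exists_isSMulRegular_notMem_sq hass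
  have hnt : Nontrivial (A ⧸ Ideal.span {x}) := Ideal.Quotient.nontrivial_iff.2 fun htop ↦
    (IsLocalRing.maximalIdeal.isMaximal A).ne_top (top_le_iff.1 (htop ▸
      (Ideal.span_singleton_le_iff_mem _).2 hx))
  have : IsLocalRing (A ⧸ Ideal.span {x}) :=
    IsLocalRing.of_surjective' _ Ideal.Quotient.mk_surjective
  obtain ⟨e, he⟩ := IsLocalRing.exists_ringKrullDim_eq_natCast (A ⧸ Ideal.span {x})
  have hlt : e < d := by
    have := ringKrullDim_quotient_span_singleton_succ_eq_ringKrullDim hreg hx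
    rw [he, hd] at this
    have : e + 1 = d := by exact_mod_cast this
    omega
  have := ih e hlt (hasProjectiveDimensionLE_residueField_quotient hx hx2 hreg n h) he
  exact IsRegularLocalRing.of_quotient_span_singleton hx hreg

end Serre

section CountablePrimeAvoidance

open IsLocalRing

variable {R : Type*} [CommRing R] [IsLocalRing R]

lemma IsLocalRing.not_pow_maximalIdeal_le {P : Ideal R} [P.IsPrime] (hP : P ≠ maximalIdeal R)
    (k : ℕ) : ¬ maximalIdeal R ^ k ≤ P := fun h ↦
  hP (le_antisymm (le_maximalIdeal Ideal.IsPrime.ne_top') (Ideal.IsPrime.le_of_pow_le h))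

variable [IsNoetherianRing R]

lemma IsLocalRing.exists_forall_add_pow_notMem {P : Ideal R} {y : R} (hy : y ∉ P) (k : ℕ) :
    ∃ k' > k, ∀ z ∈ maximalIdeal R ^ k', y + z ∉ P := by
  by_contra! hcon
  refine hy ((Submodule.Quotient.mk_eq_zero P).1 ?_)
  refine IsHausdorff.haus (I := maximalIdeal R) (M := R ⧸ P) inferInstance _ fun n ↦ ?_
  obtain ⟨z, hz, hyz⟩ := hcon (max n k + 1) (by omega)
  have hyz' : (Submodule.Quotient.mk y : R ⧸ P) = Submodule.Quotient.mk (-z) := by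
    rw [Submodule.Quotient.eq, sub_neg_eq_add]
    exact hyz
  rw [SModEq.zero, hyz', ← mul_one (-z), ← smul_eq_mul, Submodule.Quotient.mk_smul]
  exact Submodule.smul_mem_smul (neg_mem (Ideal.pow_le_pow_right (by omega) hz)) trivial

lemma IsLocalRing.exists_notMem_of_isAdicComplete [IsAdicComplete (maximalIdeal R) R]
    (P : ℕ → Ideal R) (hP : ∀ i, (P i).IsPrime) (hne : ∀ i, P i ≠ maximalIdeal R) :
    ∃ f ∈ maximalIdeal R, ∀ i, f ∉ P i := by
  have step (i : ℕ) (s : R × ℕ) : ∃ t : R × ℕ, t.1 - s.1 ∈ maximalIdeal R ^ s.2 ∧ s.2 < t.2 ∧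
      ∀ z ∈ maximalIdeal R ^ t.2, t.1 + z ∉ P i := by
    obtain ⟨y, hy, hyP⟩ : ∃ y, y - s.1 ∈ maximalIdeal R ^ s.2 ∧ y ∉ P i := by
      by_cases hs : s.1 ∈ P i
      · obtain ⟨z, hz, hzP⟩ := SetLike.not_le_iff_exists.1 (not_pow_maximalIdeal_le (hne i) s.2)
        exact ⟨s.1 + z, by simpa using hz, fun h ↦ hzP ((Submodule.add_mem_iff_right _ hs).1 h)⟩
      · exact ⟨s.1, by simp, hs⟩
    obtain ⟨k, hk, hz⟩ := exists_forall_add_pow_notMem hyP s.2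
    exact ⟨(y, k), hy, hk, hz⟩
  choose F hF₁ hF₂ hF₃ using step
  let s : ℕ → R × ℕ := fun n ↦ Nat.rec (0, 1) F n
  have hs (n : ℕ) : s (n + 1) = F n (s n) := rfl
  have hmono : StrictMono fun n ↦ (s n).2 := strictMono_nat_of_lt_succ fun n ↦ hF₂ n (s n)
  have hcauchy (a : ℕ) {b : ℕ} (hab : a ≤ b) : (s b).1 - (s a).1 ∈ maximalIdeal R ^ (s a).2 := by
    induction b, hab using Nat.le_induction with
    | base => simp
    | succ b hab ih =>
      rw [← sub_add_sub_cancel _ (s b).1]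
      exact add_mem (Ideal.pow_le_pow_right (hmono.monotone hab) (hF₁ b (s b))) ih
  obtain ⟨L, hL⟩ := IsPrecomplete.prec (I := maximalIdeal R) (M := R) inferInstance
    (f := fun n ↦ (s n).1) fun {a b} hab ↦ by
      rw [SModEq.comm, SModEq.sub_mem, smul_eq_mul, Ideal.mul_top]
      exact Ideal.pow_le_pow_right (hmono.le_apply) (hcauchy a hab)
  have hlim (a : ℕ) : L - (s a).1 ∈ maximalIdeal R ^ (s a).2 := by
    have hle : a ≤ (s a).2 := hmono.le_apply
    have h := hL (s a).2
    rw [SModEq.comm, SModEq.sub_mem, smul_eq_mul, Ideal.mul_top] at h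
    rw [← sub_add_sub_cancel _ (s (s a).2).1]
    exact add_mem h (hcauchy a hle)
  refine ⟨L, by simpa [s] using hlim 0, fun i ↦ ?_⟩
  rw [← add_sub_cancel (s (i + 1)).1 L]
  exact hF₃ i (s i) _ (hlim (i + 1))

lemma IsLocalRing.exists_notMem_of_uncountable [Uncountable (ResidueField R)]
    (P : ℕ → Ideal R) (hne : ∀ i, ¬ maximalIdeal R ≤ P i) :
    ∃ f ∈ maximalIdeal R, ∀ i, f ∉ P i := by
  obtain ⟨n, g, hg⟩ := Submodule.fg_iff_exists_fin_generating_family.1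
    (IsNoetherian.noetherian (maximalIdeal R))
  have hgm (i : Fin n) : g i ∈ maximalIdeal R := hg ▸ Submodule.subset_span ⟨i, rfl⟩
  obtain ⟨σ, hσ⟩ := (residue_surjective (R := R)).hasRightInverse
  by_contra! hcon
  let f : ResidueField R → R := fun u ↦ ∑ i : Fin n, σ u ^ (i : ℕ) * g i
  choose j hj using fun u ↦ hcon (f u) (sum_mem fun i _ ↦ Ideal.mul_mem_left _ _ (hgm i))
  obtain ⟨l, hl⟩ : ∃ l, (j ⁻¹' {l}).Infinite := by
    by_contra! hfin
    refine Set.not_countable_univ (α := ResidueField R) ?_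
    rw [← Set.preimage_univ (f := j), ← Set.biUnion_of_singleton (Set.univ : Set ℕ),
      Set.preimage_iUnion₂]
    exact Set.countable_univ.biUnion fun l _ ↦ (hfin l).countable
  have := hl.to_subtype
  let v : Fin n ↪ j ⁻¹' {l} := Fin.valEmbedding.trans (Infinite.natEmbedding _)
  let V : Matrix (Fin n) (Fin n) R := Matrix.vandermonde fun a ↦ σ (v a)
  have hV : IsUnit V.det := by
    rw [← isUnit_map_iff (residue R), isUnit_iff_ne_zero, RingHom.map_det,
      show (residue R).mapMatrix V = Matrix.vandermonde fun a ↦ (v a : ResidueField R) by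
        ext a b; simp [V, Matrix.vandermonde_apply, hσ (v a : ResidueField R)],
      Matrix.det_vandermonde_ne_zero_iff]
    exact Subtype.val_injective.comp v.injective
  have hVg (a : Fin n) : (V.mulVec g) a ∈ P l := by
    have := hj (v a)
    rwa [show j (v a) = l from (v a).2] at this
  refine hne l ?_
  rw [← hg, Submodule.span_le]
  rintro _ ⟨i, rfl⟩
  have : g = V⁻¹.mulVec (V.mulVec g) := by
    rw [Matrix.mulVec_mulVec, Matrix.nonsing_inv_mul _ hV, Matrix.one_mulVec]
  rw [this, SetLike.mem_coe, Matrix.mulVec, dotProduct]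
  exact Submodule.sum_mem (P l) fun a _ ↦ Ideal.mul_mem_left _ _ (hVg a)

/-- If a noetherian local ring `R` is complete or has uncountable residue field, then `dim R/p ≤ 1`
for every prime `p` such that `V(p)` is countable. -/
lemma IsLocalRing.ringKrullDim_quotient_le_one
    (hR : IsAdicComplete (maximalIdeal R) R ∨ Uncountable (ResidueField R))
    (p : Ideal R) [p.IsPrime] (hp : {q : PrimeSpectrum R | p ≤ q.asIdeal}.Countable) :
    ringKrullDim (R ⧸ p) ≤ 1 := by
  obtain ⟨f, hf, hfq⟩ : ∃ f ∈ maximalIdeal R, ∀ q : PrimeSpectrum R, p ≤ q.asIdeal →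
      f ∈ q.asIdeal → q.asIdeal = maximalIdeal R := by
    let Z : Set (PrimeSpectrum R) := {q | p ≤ q.asIdeal ∧ q.asIdeal ≠ maximalIdeal R}
    have hZ : Z.Countable := hp.mono fun q hq ↦ hq.1
    rcases Z.eq_empty_or_nonempty with hempty | hne
    · refine ⟨0, zero_mem _, fun q hq _ ↦ by_contra fun hqm ↦ ?_⟩
      exact Set.notMem_empty q (hempty ▸ ⟨hq, hqm⟩)
    · obtain ⟨P, hP⟩ := hZ.exists_eq_range hne
      have hPZ (i : ℕ) : P i ∈ Z := hP ▸ Set.mem_range_self i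
      obtain ⟨f, hf, hfP⟩ : ∃ f ∈ maximalIdeal R, ∀ i, f ∉ (P i).asIdeal := by
        rcases hR with h | h
        · exact exists_notMem_of_isAdicComplete _ (fun i ↦ (P i).isPrime) fun i ↦ (hPZ i).2
        · exact exists_notMem_of_uncountable _ fun i hle ↦
            (hPZ i).2 (le_antisymm (le_maximalIdeal (P i).isPrime.ne_top) hle)
      refine ⟨f, hf, fun q hq hfq ↦ by_contra fun hqm ↦ ?_⟩
      obtain ⟨i, rfl⟩ : q ∈ Set.range P := hP ▸ ⟨hq, hqm⟩
      exact hfP i hfq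
  have : IsLocalRing (R ⧸ p) := IsLocalRing.of_surjective' _ Ideal.Quotient.mk_surjective
  have hloc : IsLocalHom (Ideal.Quotient.mk p) :=
    IsLocalHom.of_surjective _ Ideal.Quotient.mk_surjective
  have hcomap : (maximalIdeal (R ⧸ p)).comap (Ideal.Quotient.mk p) = maximalIdeal R :=
    ((local_hom_TFAE (Ideal.Quotient.mk p)).out 0 4).1 hloc
  have hmin : maximalIdeal (R ⧸ p) ∈ (Ideal.span {Ideal.Quotient.mk p f}).minimalPrimes := by
    refine ⟨⟨inferInstance, ?_⟩, fun Q hQ _ ↦ ?_⟩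
    · rw [Ideal.span_singleton_le_iff_mem, ← Ideal.mem_comap, hcomap]
      exact hf
    · have := hQ.1
      have hQm := hfq ⟨Q.comap (Ideal.Quotient.mk p), inferInstance⟩
        (Ideal.mk_ker.ge.trans (Ideal.ker_le_comap (Ideal.Quotient.mk p)))
        (hQ.2 (Ideal.mem_span_singleton_self _))
      rw [← Ideal.map_comap_of_surjective _ Ideal.Quotient.mk_surjective (maximalIdeal (R ⧸ p)),
        hcomap, ← hQm, Ideal.map_comap_of_surjective _ Ideal.Quotient.mk_surjective]
  have := Ideal.height_le_one_of_isPrincipal_of_mem_minimalPrimes _ _ hmin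
  rw [← maximalIdeal_height_eq_ringKrullDim]
  exact_mod_cast this

end CountablePrimeAvoidance

section NonfreeLocus

variable {R : Type} [CommRing R]

lemma Module.freeLocus_subset_of_retract [IsNoetherianRing R] {X Y : Type*} [AddCommGroup X]
    [Module R X] [AddCommGroup Y] [Module R Y] [Module.Finite R X] (i : Y →ₗ[R] X)
    (π : X →ₗ[R] Y) (h : π ∘ₗ i = LinearMap.id) :
    Module.freeLocus R X ⊆ Module.freeLocus R Y := by
  intro p hp
  rw [Module.mem_freeLocus_iff_tensor p (Localization.AtPrime p.asIdeal)] at hp ⊢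
  have : Module.Finite R Y := Module.Finite.of_surjective π
    (LinearMap.surjective_of_comp_eq_id _ _ h)
  have := Module.Projective.of_split (i.baseChange (Localization.AtPrime p.asIdeal))
    (π.baseChange (Localization.AtPrime p.asIdeal)) (by
      rw [← LinearMap.baseChange_comp, h, LinearMap.baseChange_id])
  exact Module.free_of_flat_of_isLocalRing

lemma Module.mem_freeLocus_prod {A B : Type*} [AddCommGroup A] [Module R A] [AddCommGroup B]
    [Module R B] {p : PrimeSpectrum R} (hA : p ∈ Module.freeLocus R A)
    (hB : p ∈ Module.freeLocus R B) : p ∈ Module.freeLocus R (A × B) := by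
  rw [Module.mem_freeLocus_iff_tensor p (Localization.AtPrime p.asIdeal)] at hA hB ⊢
  exact Module.Free.of_equiv
    (TensorProduct.prodRight R (Localization.AtPrime p.asIdeal)
      (Localization.AtPrime p.asIdeal) A B).symm

lemma Module.mem_freeLocus_of_le {M : Type*} [AddCommGroup M] [Module R M]
    [Module.FinitePresentation R M] {p q : PrimeSpectrum R} (hpq : p ≤ q)
    (hq : q ∈ Module.freeLocus R M) : p ∈ Module.freeLocus R M :=
  ((PrimeSpectrum.le_iff_specializes p q).1 hpq).mem_open Module.isOpen_freeLocus hq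

lemma exists_indec_retract [IsNoetherianRing R] (X : ModuleCat.{0} R) [Module.Finite R X]
    {q : PrimeSpectrum R} (hq : q ∉ Module.freeLocus R X) :
    ∃ (Y : ModuleCat.{0} R) (i : Y →ₗ[R] X) (π : X →ₗ[R] Y), π ∘ₗ i = LinearMap.id ∧
      Indec R Y ∧ q ∉ Module.freeLocus R Y := by
  let W : Set (Submodule R X) := {W | ∃ (Y : ModuleCat.{0} R) (i : Y →ₗ[R] X) (π : X →ₗ[R] Y),
    π ∘ₗ i = LinearMap.id ∧ q ∉ Module.freeLocus R Y ∧ LinearMap.ker π = W}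
  obtain ⟨_, ⟨Y, i, π, hπi, hqY, rfl⟩, hmax⟩ := set_has_maximal_iff_noetherian.2
    (inferInstance : IsNoetherian R X) W ⟨_, X, .id, .id, rfl, hq, rfl⟩
  have key (A B : Type) [AddCommGroup A] [Module R A] [AddCommGroup B] [Module R B]
      [Nontrivial B] (e : Y ≃ₗ[R] A × B) : q ∈ Module.freeLocus R A := by
    by_contra hqA
    refine hmax (LinearMap.ker (LinearMap.fst R A B ∘ₗ e.toLinearMap ∘ₗ π))
      ⟨ModuleCat.of R A, i ∘ₗ e.symm.toLinearMap ∘ₗ LinearMap.inl R A B, _, ?_, hqA, rfl⟩ ?_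
    · ext a
      have : π (i (e.symm (a, 0))) = e.symm (a, 0) := LinearMap.congr_fun hπi _
      simp [this]
    · refine lt_of_le_of_ne (fun x hx ↦ by simp [LinearMap.mem_ker.1 hx]) fun heq ↦ ?_
      obtain ⟨b, hb⟩ := exists_ne (0 : B)
      have hπ : π (i (e.symm (0, b))) = e.symm (0, b) := LinearMap.congr_fun hπi _
      have hmem : i (e.symm (0, b)) ∈ LinearMap.ker π := by
        rw [heq]
        simp [hπ]
      rw [LinearMap.mem_ker, hπ] at hmem
      simp_all
  refine ⟨Y, i, π, hπi, ⟨?_, fun A B _ _ ↦ ⟨fun e ↦ hqY ?_⟩⟩, hqY⟩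
  · by_contra hY
    rw [not_nontrivial_iff_subsingleton] at hY
    exact hqY (Module.mem_freeLocus.2 inferInstance)
  · rw [Module.freeLocus_congr e.toLinearEquiv]
    exact Module.mem_freeLocus_prod (key A B e.toLinearEquiv)
      (key B A (e.toLinearEquiv.trans (LinearEquiv.prodComm R A B)))

end NonfreeLocus

section Depth

variable {R : Type} [CommRing R] [IsNoetherianRing R] [IsLocalRing R]

lemma moduleDepth_eq_ringKrullDim (M : Type) [AddCommGroup M] [Module R M] [Module.Finite R M]
    [Nontrivial M] {rs : List R} (hrs : ∀ r ∈ rs, r ∈ IsLocalRing.maximalIdeal R)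
    (hlen : (rs.length : WithBot ℕ∞) = ringKrullDim R) (hM : IsWeaklyRegular M rs) :
    (moduleDepth R M : WithBot ℕ∞) = ringKrullDim R := by
  have hle : moduleDepth R M ≤ rs.length := by
    refine iSup₂_le fun ss hss ↦ ?_
    have hnt : Nontrivial (M ⧸ Ideal.ofList ss • (⊤ : Submodule R M)) :=
      Submodule.Quotient.nontrivial_iff.2 hss.2.top_ne_smul.symm
    have hnn : 0 ≤ Module.supportDim R (M ⧸ Ideal.ofList ss • (⊤ : Submodule R M)) :=
      Order.krullDim_nonneg_iff.2 (Module.nonempty_support_iff.2 hnt).to_subtype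
    have h := (le_add_of_nonneg_left hnn).trans
      ((Module.supportDim_add_length_eq_supportDim_of_isRegular ss hss.2).le.trans
        ((Module.supportDim_le_ringKrullDim R M).trans hlen.ge))
    exact_mod_cast h
  have hge : (rs.length : ℕ∞) ≤ moduleDepth R M :=
    le_iSup₂_of_le rs ⟨hrs, .of_isWeaklyRegular_of_mem_maximalIdeal _ hrs hM⟩ le_rfl
  rw [← hlen, le_antisymm hle hge]
  rfl

lemma exists_isWeaklyRegular_length_eq (h : (moduleDepth R R : WithBot ℕ∞) = ringKrullDim R) :
    ∃ rs : List R, (∀ r ∈ rs, r ∈ IsLocalRing.maximalIdeal R) ∧ IsWeaklyRegular R rs ∧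
      (rs.length : WithBot ℕ∞) = ringKrullDim R := by
  obtain ⟨d, hd⟩ := IsLocalRing.exists_ringKrullDim_eq_natCast R
  rw [hd] at h ⊢
  have hdep : moduleDepth R R = d := by exact_mod_cast h
  by_contra! hcon
  have hne (rs : List R) (hrs : (∀ r ∈ rs, r ∈ IsLocalRing.maximalIdeal R) ∧ IsRegular R rs) :
      rs.length ≠ d := fun he ↦ hcon rs hrs.1 hrs.2.toIsWeaklyRegular (by rw [he])
  have hle (rs : List R) (hrs : (∀ r ∈ rs, r ∈ IsLocalRing.maximalIdeal R) ∧ IsRegular R rs) :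
      rs.length ≤ d := by
    have : (rs.length : ℕ∞) ≤ moduleDepth R R := le_iSup₂_of_le rs hrs le_rfl
    rw [hdep] at this
    exact_mod_cast this
  have hd0 : d ≠ 0 := fun h0 ↦ hne [] ⟨by simp, IsRegular.nil R R⟩ (by simp [h0])
  have : moduleDepth R R ≤ ((d - 1 : ℕ) : ℕ∞) := iSup₂_le fun rs hrs ↦ by
    have h₁ := hne rs hrs
    have h₂ := hle rs hrs
    exact_mod_cast (by omega : rs.length ≤ d - 1)
  rw [hdep] at this
  have : d ≤ d - 1 := by exact_mod_cast this
  omega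

end Depth

section SingularLocus

variable {R : Type} [CommRing R]

lemma hasProjectiveDimensionLE_localizedModule_quotient_iff (I : Ideal R) (q : PrimeSpectrum R)
    (n : ℕ) :
    HasProjectiveDimensionLE (ModuleCat.of (Localization.AtPrime q.asIdeal)
      (LocalizedModule q.asIdeal.primeCompl (R ⧸ I))) n ↔
    HasProjectiveDimensionLE (ModuleCat.of (Localization.AtPrime q.asIdeal)
      (Localization.AtPrime q.asIdeal ⧸
        I.map (algebraMap R (Localization.AtPrime q.asIdeal)))) n := by
  let e := (LocalizedModule.equivTensorProduct q.asIdeal.primeCompl (R ⧸ I)).trans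
    (Ideal.qoutMapEquivTensorQout (Localization.AtPrime q.asIdeal) (I := I)).symm
  exact ⟨fun h ↦ hasProjectiveDimensionLT_of_iso e.toModuleIso _,
    fun h ↦ hasProjectiveDimensionLT_of_iso e.symm.toModuleIso _⟩

variable [IsNoetherianRing R]

lemma notMem_singularLocus_of_isRegularLocalRing {p : PrimeSpectrum R}
    (h : IsRegularLocalRing (Localization.AtPrime p.asIdeal)) : p ∉ singularLocus R := by
  obtain ⟨s, hs, hspan⟩ := Submodule.FG.exists_span_finset_card_eq_spanFinrank
    (IsNoetherian.noetherian (IsLocalRing.maximalIdeal (Localization.AtPrime p.asIdeal)))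
  exact not_not_intro ⟨s, hspan, by
    rw [hs, ← IsRegularLocalRing.spanFinrank_maximalIdeal]⟩

/-- If `R_p` is not regular, then neither is `R_q` for `q ⊇ p`, so that the residue field of `R_q`
has infinite projective dimension. -/
lemma not_hasProjectiveDimensionLE_of_mem_singularLocus {p q : PrimeSpectrum R}
    (hp : p ∈ singularLocus R) (hpq : p ≤ q) (n : ℕ) :
    ¬ HasProjectiveDimensionLE (ModuleCat.of (Localization.AtPrime q.asIdeal)
      (LocalizedModule q.asIdeal.primeCompl (R ⧸ q.asIdeal))) n := by
  intro h
  rw [hasProjectiveDimensionLE_localizedModule_quotient_iff,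
    Localization.AtPrime.map_eq_maximalIdeal] at h
  have hq := hasProjectiveDimensionLT_quotient_of_residueField (n + 1)
    (p.asIdeal.map (algebraMap R (Localization.AtPrime q.asIdeal)))
  obtain ⟨K, _, _, _, -, hK⟩ := exists_syzygy (R := R) n (R ⧸ p.asIdeal)
  have hKq : q ∈ Module.freeLocus R K := by
    rw [Module.mem_freeLocus, ← hasProjectiveDimensionLE_zero_iff_free, ← hK,
      hasProjectiveDimensionLE_localizedModule_quotient_iff]
    exact hq
  have := Module.finitePresentation_of_finite R K
  have hKp := Module.mem_freeLocus_of_le hpq hKq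
  rw [Module.mem_freeLocus, ← hasProjectiveDimensionLE_zero_iff_free, ← hK,
    hasProjectiveDimensionLE_localizedModule_quotient_iff,
    Localization.AtPrime.map_eq_maximalIdeal] at hKp
  exact notMem_singularLocus_of_isRegularLocalRing
    (isRegularLocalRing_of_hasProjectiveDimensionLE _ hKp) hp

/-- Over a Cohen-Macaulay local ring, every specialization `q` of a singular prime is the smallest
nonfree prime of an indecomposable maximal Cohen-Macaulay module. -/
lemma exists_indec_freeLocus_compl [IsLocalRing R]
    (hCM : (moduleDepth R R : WithBot ℕ∞) = ringKrullDim R) {p q : PrimeSpectrum R}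
    (hp : p ∈ singularLocus R) (hpq : p ≤ q) :
    ∃ Y : ModuleCat.{0} R, Module.Finite R Y ∧ (moduleDepth R Y : WithBot ℕ∞) = ringKrullDim R ∧
      Indec R Y ∧ IsLeast (Module.freeLocus R Y)ᶜ q := by
  obtain ⟨rs, hrs, hreg, hlen⟩ := exists_isWeaklyRegular_length_eq hCM
  obtain ⟨K, _, _, _, hK, hpd⟩ := exists_syzygy (R := R) rs.length (R ⧸ q.asIdeal)
  have hKreg : IsWeaklyRegular K rs := by simpa using hK rs hreg
  have hfree (r : PrimeSpectrum R) : r ∈ Module.freeLocus R K ↔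
      HasProjectiveDimensionLE (ModuleCat.of (Localization.AtPrime r.asIdeal)
        (LocalizedModule r.asIdeal.primeCompl (R ⧸ q.asIdeal))) rs.length := by
    rw [Module.mem_freeLocus, ← hasProjectiveDimensionLE_zero_iff_free, ← hpd, add_zero]
  have hqK : q ∉ Module.freeLocus R K := fun h ↦
    not_hasProjectiveDimensionLE_of_mem_singularLocus hp hpq _ ((hfree q).1 h)
  obtain ⟨Y, i, π, hπi, hY, hqY⟩ := exists_indec_retract (ModuleCat.of R K) hqK
  have hYfin : Module.Finite R Y := Module.Finite.of_surjective π
    (LinearMap.surjective_of_comp_eq_id _ _ hπi)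
  have := hY.1
  refine ⟨Y, hYfin, moduleDepth_eq_ringKrullDim Y hrs hlen (.of_retract rs i π hπi hKreg), hY,
    hqY, fun r hr ↦ ?_⟩
  by_contra hqr
  obtain ⟨a, haq, har⟩ := SetLike.not_le_iff_exists.1 (show ¬ q.asIdeal ≤ r.asIdeal from hqr)
  refine hr (Module.freeLocus_subset_of_retract i π hπi ((hfree r).2 ?_))
  have : Subsingleton (LocalizedModule r.asIdeal.primeCompl (R ⧸ q.asIdeal)) :=
    LocalizedModule.subsingleton_iff.2 fun x ↦ by
      obtain ⟨x, rfl⟩ := Submodule.Quotient.mk_surjective _ x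
      refine ⟨a, har, ?_⟩
      rw [← Submodule.Quotient.mk_smul, Submodule.Quotient.mk_eq_zero]
      exact Ideal.mul_mem_right _ _ haq
  have hz : Limits.IsZero (ModuleCat.of (Localization.AtPrime r.asIdeal)
    (LocalizedModule r.asIdeal.primeCompl (R ⧸ q.asIdeal))) := ModuleCat.isZero_of_subsingleton _
  have := hz.hasProjectiveDimensionLT_zero
  exact hasProjectiveDimensionLT_of_ge _ 0 _ (Nat.zero_le _)

end SingularLocus

/-- A complete (or uncountable-residue-field) Cohen-Macaulay
noetherian local ring of countable Cohen-Macaulay representation type has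
`dim Sing R ≤ 1`. -/
theorem stmt19 (R : Type) [CommRing R] [IsNoetherianRing R] [IsLocalRing R]
    (hCM : (moduleDepth R R : WithBot ℕ∞) = ringKrullDim R)
    (hR : IsAdicComplete (IsLocalRing.maximalIdeal R) R ∨
      Uncountable (IsLocalRing.ResidueField R))
    (hcount : ∃ S : Set (ModuleCat R), S.Countable ∧
      ∀ M : ModuleCat R, Module.Finite R M →
        (moduleDepth R M : WithBot ℕ∞) = ringKrullDim R → Indec R M →
        ∃ N ∈ S, Nonempty (M ≅ N)) :
    dimSet R (singularLocus R) ≤ 1 := by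
  refine iSup₂_le fun p hp ↦ IsLocalRing.ringKrullDim_quotient_le_one hR p.asIdeal ?_
  obtain ⟨S, hS, hSM⟩ := hcount
  choose! Y hYfin hYdepth hY hYleast using
    fun (q : PrimeSpectrum R) (hq : p ≤ q) ↦ exists_indec_freeLocus_compl hCM hp hq
  choose! N hNS hN using fun (q : PrimeSpectrum R) (hq : p ≤ q) ↦
    hSM (Y q) (hYfin q hq) (hYdepth q hq) (hY q hq)
  refine Set.MapsTo.countable_of_injOn (f := N) (t := S) hNS (fun q hq q' hq' hqq' ↦ ?_) hS
  have hlocus : Module.freeLocus R (Y q) = Module.freeLocus R (Y q') := by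
    rw [Module.freeLocus_congr (hN q hq).some.toLinearEquiv,
      Module.freeLocus_congr (hN q' hq').some.toLinearEquiv, hqq']
  exact (hYleast q hq).unique (hlocus ▸ hYleast q' hq')
end
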